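/- Let U ∈ 𝒰 be differentiable on (0,π] and suppose there are constants c > 1, C > 0 and t₀ ∈ (0,1) such that for all 0 < t < t₀ one has t·U'(t)/U(t) ≤ 1 + c/|log t| and U(t)/(t·h_U(t)) ≤ C/(|log t|·log|log t|). Let T = C_{φ_U} be the composition operator with symbol φ_U. Then there exist constants 0 < c₁ ≤ C₁ and N such that for all n ≥ N: c₁·(h_U(e^{−√n}))^{−1/2} ≤ a_n(T) ≤ C₁·(h_U(e^{−√n}))^{−1/2}. -/

import Mathlib

open Complex MeasureTheory Filter Set

noncomputable section

abbrev H2 : Type := lp (fun _ : ℕ => ℂ) 2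

/-- `f_a(z) = ∑ a_k z^k`, identifying `ℓ²` with the Hardy space `H²`. -/
noncomputable def fa (a : H2) (z : ℂ) : ℂ := ∑' k : ℕ, a k * z ^ k

/-- The `n`-th approximation number of a bounded operator on `ℓ²`. -/
noncomputable def approxNum (T : H2 →L[ℂ] H2) (n : ℕ) : ℝ :=
  sInf {c : ℝ | ∃ R : H2 →L[ℂ] H2,
    FiniteDimensional ℂ (LinearMap.range R.toLinearMap) ∧
    Module.finrank ℂ (LinearMap.range R.toLinearMap) ≤ n - 1 ∧ c = ‖T - R‖}

/-- `h_U(t) = ∫_t^π U(x)/x² dx`. -/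
noncomputable def hU (U : ℝ → ℝ) (t : ℝ) : ℝ := ∫ x in t..Real.pi, U x / x ^ 2

/-- The class 𝒰. -/
def ClassU (U : ℝ → ℝ) : Prop :=
  Continuous U ∧ (∀ t, U (-t) = U t) ∧ Function.Periodic U (2 * Real.pi) ∧
  U 0 = 0 ∧ MonotoneOn U (Set.Icc 0 Real.pi) ∧
  (∀ t, 0 < t → t ≤ Real.pi → 0 < U t) ∧
  Tendsto (fun t => hU U t) (nhdsWithin 0 (Set.Ioi 0)) atTop

/-- The Poisson extension of `U`, evaluated at `r·e^{iθ}`. -/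
noncomputable def poisson (U : ℝ → ℝ) (r θ : ℝ) : ℝ :=
  ((1 - r ^ 2) / (2 * Real.pi)) *
    ∫ x in (-Real.pi)..Real.pi, U x / (1 - 2 * r * Real.cos (θ - x) + r ^ 2)

/-- reproducing kernel coefficients -/
lemma kz_mem (z : ℂ) (hz : ‖z‖ < 1) :
    Memℓp (fun m : ℕ => (starRingEnd ℂ z) ^ m) 2 := by
  rw [memℓp_gen_iff (by norm_num)]
  simp only [norm_pow, RCLike.norm_conj]
  have : Summable (fun m : ℕ => (‖z‖ ^ 2) ^ m) :=
    summable_geometric_of_lt_one (by positivity) (by nlinarith [norm_nonneg z])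
  refine this.congr fun m => ?_
  norm_num
  rw [← pow_mul, ← pow_mul, mul_comm]

/-- Reproducing kernel of the Hardy space at `z`. -/
def kz (z : ℂ) (hz : ‖z‖ < 1) : H2 := ⟨fun m : ℕ => (starRingEnd ℂ z) ^ m, kz_mem z hz⟩

lemma inner_kz (z : ℂ) (hz : ‖z‖ < 1) (a : H2) : inner ℂ (kz z hz) a = fa a z := by
  rw [lp.inner_eq_tsum, fa]
  congr 1; ext m
  simp [kz]

lemma inner_kz_kz (z w : ℂ) (hz : ‖z‖ < 1) (hw : ‖w‖ < 1) :
    inner ℂ (kz z hz) (kz w hw) = (1 - starRingEnd ℂ w * z)⁻¹ := by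
  rw [inner_kz, fa, ← tsum_geometric_of_norm_lt_one]
  · congr 1; ext m; simp [kz, mul_pow]
  · rw [norm_mul, RCLike.norm_conj]; nlinarith [norm_nonneg z, norm_nonneg w]

lemma norm_kz_sq (z : ℂ) (hz : ‖z‖ < 1) : ‖kz z hz‖ ^ 2 = 1 / (1 - ‖z‖ ^ 2) := by
  have h := inner_self_eq_norm_sq_to_K (𝕜 := ℂ) (kz z hz)
  rw [inner_kz_kz, ← Complex.normSq_eq_conj_mul_self, Complex.normSq_eq_norm_sq] at h
  have h2 : (((1 - ‖z‖ ^ 2)⁻¹ : ℝ) : ℂ) = ((‖kz z hz‖ ^ 2 : ℝ) : ℂ) := by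
    push_cast; push_cast at h; exact h
  rw [one_div]; exact (Complex.ofReal_injective h2).symm

lemma norm_fa_sq_le (a : H2) (z : ℂ) (hz : ‖z‖ < 1) :
    ‖fa a z‖ ^ 2 ≤ ‖a‖ ^ 2 / (1 - ‖z‖ ^ 2) := by
  rw [← inner_kz z hz]
  have h := norm_inner_le_norm (𝕜 := ℂ) (kz z hz) a
  calc _ ≤ (‖kz z hz‖ * ‖a‖) ^ 2 := by gcongr
    _ = _ := by rw [mul_pow, norm_kz_sq]; ring

lemma H2_norm_sq (a : H2) : HasSum (fun k => ‖a k‖ ^ 2) (‖a‖ ^ 2) := by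
  have := lp.hasSum_norm (p := 2) (by norm_num) a
  simpa using this

lemma H2_coef_le (a : H2) (k : ℕ) : ‖a k‖ ≤ ‖a‖ := lp.norm_apply_le_norm (by norm_num) a k

lemma fa_summable_norm (a : H2) (r : ℝ) (h0 : 0 ≤ r) (h1 : r < 1) :
    Summable (fun k => ‖a k‖ * r ^ k) := by
  refine Summable.of_nonneg_of_le (fun k => by positivity) (fun k => ?_)
    ((summable_geometric_of_lt_one h0 h1).mul_left ‖a‖)
  gcongr; exact H2_coef_le a k

lemma fa_hasSum (a : H2) (z : ℂ) (hz : ‖z‖ < 1) : HasSum (fun k => a k * z ^ k) (fa a z) := by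
  apply Summable.hasSum
  apply Summable.of_norm
  simpa [norm_mul, norm_pow] using fa_summable_norm a ‖z‖ (norm_nonneg z) hz

lemma fa_add (a b : H2) (z : ℂ) (hz : ‖z‖ < 1) : fa (a + b) z = fa a z + fa b z := by
  simp only [← inner_kz z hz, inner_add_right]

lemma fa_smul (c : ℂ) (a : H2) (z : ℂ) (hz : ‖z‖ < 1) : fa (c • a) z = c * fa a z := by
  simp only [← inner_kz z hz, inner_smul_right]

lemma fa_diff (a : H2) : DifferentiableOn ℂ (fa a) (Metric.ball 0 1) := by
  intro z hz
  have hz' : ‖z‖ < 1 := by simpa using hz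
  obtain ⟨r, hr1, hr2⟩ := exists_between hz'
  have hr0 : 0 ≤ r := (norm_nonneg z).trans hr1.le
  have : DifferentiableOn ℂ (fun w => ∑' k : ℕ, a k * w ^ k) (Metric.ball 0 r) := by
    refine differentiableOn_tsum_of_summable_norm (fa_summable_norm a r hr0 hr2)
      (fun k => by fun_prop) Metric.isOpen_ball (fun k w hw => ?_)
    rw [norm_mul, norm_pow]
    have : ‖w‖ < r := by simpa using hw
    gcongr
  exact ((this.differentiableAt (Metric.isOpen_ball.mem_nhds (by simpa using hr1)))).differentiableWithinAt

lemma fa_cont (a : H2) : ContinuousOn (fa a) (Metric.ball 0 1) := (fa_diff a).continuousOn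

lemma exp_int_integral (k : ℤ) (hk : k ≠ 0) :
    ∫ θ in (0:ℝ)..(2 * Real.pi), Complex.exp (k * (θ * I)) = 0 := by
  have hc : (k * I : ℂ) ≠ 0 := by simp [hk]
  have : ∀ θ : ℝ, Complex.exp (k * (θ * I)) = Complex.exp ((k * I) * θ) := fun θ => by ring_nf
  simp only [this]
  rw [integral_exp_mul_complex hc]
  have : (k * I * ((2 * Real.pi : ℝ) : ℂ)) = k * (2 * Real.pi * I) := by push_cast; ring
  rw [this, Complex.exp_int_mul_two_pi_mul_I]; simp

/-- Fourier coefficient of `fa` on a circle. -/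
lemma fa_coef (a : H2) (r : ℝ) (h0 : 0 ≤ r) (h1 : r < 1) (k : ℕ) :
    ∫ θ in (0:ℝ)..(2 * Real.pi), starRingEnd ℂ (fa a (circleMap 0 r θ)) * circleMap 0 r θ ^ k
      = (2 * Real.pi) * (starRingEnd ℂ (a k) * r ^ (2 * k)) := by
  have hs := fa_summable_norm a r h0 h1
  have hn : ∀ θ, ‖circleMap 0 r θ‖ = r := fun θ => by simp [abs_of_nonneg h0]
  have key : HasSum (fun j : ℕ => ∫ θ in (0:ℝ)..(2 * Real.pi),
      starRingEnd ℂ (a j * circleMap 0 r θ ^ j) * circleMap 0 r θ ^ k)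
      (∫ θ in (0:ℝ)..(2 * Real.pi), starRingEnd ℂ (fa a (circleMap 0 r θ)) * circleMap 0 r θ ^ k) := by
    apply intervalIntegral.hasSum_integral_of_dominated_convergence
      (fun j _ => ‖a j‖ * r ^ j * r ^ k)
    · intro j
      apply Continuous.aestronglyMeasurable
      have := continuous_circleMap 0 r
      fun_prop
    · intro j; filter_upwards with θ _
      simp [hn]
    · filter_upwards with θ _
      exact hs.mul_right _
    · simp
    · filter_upwards with θ _
      have := fa_hasSum a (circleMap 0 r θ) (by rw [hn]; exact h1)
      have h4 := this.map (starRingEnd ℂ) Complex.continuous_conj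
      exact h4.mul_right _
  have h2 : ∀ j : ℕ, ∫ θ in (0:ℝ)..(2 * Real.pi),
      starRingEnd ℂ (a j * circleMap 0 r θ ^ j) * circleMap 0 r θ ^ k =
      if j = k then (2 * Real.pi) * (starRingEnd ℂ (a k) * r ^ (2 * k)) else 0 := by
    intro j
    have : ∀ θ : ℝ, starRingEnd ℂ (a j * circleMap 0 r θ ^ j) * circleMap 0 r θ ^ k =
        (starRingEnd ℂ (a j) * r ^ (j + k)) * Complex.exp (((k - j : ℤ) : ℂ) * (θ * I)) := by
      intro θ
      simp only [circleMap, zero_add, map_mul, map_pow, ← Complex.exp_conj, Complex.conj_ofReal,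
        Complex.conj_I, mul_pow, ← Complex.exp_nat_mul, map_natCast]
      rw [show starRingEnd ℂ (a j) * ((r:ℂ) ^ j * cexp (j * (θ * -I))) * ((r:ℂ) ^ k * cexp (k * (θ * I)))
        = (starRingEnd ℂ (a j) * r ^ (j + k)) * (cexp (j * (θ * -I)) * cexp (k * (θ * I))) by ring,
        ← Complex.exp_add]
      congr 2; push_cast; ring
    simp only [this]
    rw [intervalIntegral.integral_const_mul]
    split_ifs with hjk
    · subst hjk; simp; ring
    · rw [exp_int_integral _ (by omega), mul_zero]
  simp only [h2] at key
  exact key.unique (by simpa using hasSum_ite_eq k ((2 * Real.pi) * (starRingEnd ℂ (a k) * r ^ (2 * k)) : ℂ))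

lemma fa_circle_cont (a : H2) (r : ℝ) (h0 : 0 ≤ r) (h1 : r < 1) :
    Continuous (fun θ => fa a (circleMap 0 r θ)) := by
  refine (fa_cont a).comp_continuous (continuous_circleMap 0 r) (fun θ => ?_)
  simpa [abs_of_nonneg h0] using h1

/-- Parseval -/
lemma fa_parseval (a : H2) (r : ℝ) (h0 : 0 ≤ r) (h1 : r < 1) :
    HasSum (fun k => ‖a k‖ ^ 2 * r ^ (2 * k))
      (Real.circleAverage (fun z => ‖fa a z‖ ^ 2) 0 r) := by
  have hs := fa_summable_norm a r h0 h1
  have hn : ∀ θ, ‖circleMap 0 r θ‖ = r := fun θ => by simp [abs_of_nonneg h0]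
  have hcont := fa_circle_cont a r h0 h1
  obtain ⟨B, hB⟩ : ∃ B : ℝ, ∀ θ, ‖fa a (circleMap 0 r θ)‖ ≤ B := by
    refine ⟨∑' k, ‖a k‖ * r ^ k, fun θ => ?_⟩
    rw [fa]
    refine (norm_tsum_le_tsum_norm ?_).trans_eq ?_
    · simpa [hn] using hs
    · simp [hn]
  have hB0 : 0 ≤ B := (norm_nonneg _).trans (hB 0)
  have key : HasSum (fun j : ℕ => ∫ θ in (0:ℝ)..(2 * Real.pi),
      starRingEnd ℂ (fa a (circleMap 0 r θ)) * (a j * circleMap 0 r θ ^ j))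
      (∫ θ in (0:ℝ)..(2 * Real.pi), starRingEnd ℂ (fa a (circleMap 0 r θ)) * fa a (circleMap 0 r θ)) := by
    apply intervalIntegral.hasSum_integral_of_dominated_convergence
      (fun j _ => B * (‖a j‖ * r ^ j))
    · intro j
      apply Continuous.aestronglyMeasurable
      have := continuous_circleMap 0 r
      fun_prop
    · intro j; filter_upwards with θ _
      rw [norm_mul, RCLike.norm_conj, norm_mul, norm_pow, hn]
      gcongr; exact hB θ
    · filter_upwards with θ _
      exact hs.mul_left _
    · simp
    · filter_upwards with θ _
      have := fa_hasSum a (circleMap 0 r θ) (by rw [hn]; exact h1)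
      exact this.mul_left _
  have h2 : ∀ j : ℕ, ∫ θ in (0:ℝ)..(2 * Real.pi),
      starRingEnd ℂ (fa a (circleMap 0 r θ)) * (a j * circleMap 0 r θ ^ j) =
      (((2 * Real.pi) * (‖a j‖ ^ 2 * r ^ (2 * j)) : ℝ) : ℂ) := by
    intro j
    have := fa_coef a r h0 h1 j
    simp only [mul_left_comm _ (a j) _]
    rw [intervalIntegral.integral_const_mul, this]
    push_cast
    rw [← Complex.conj_mul' (a j)]; ring
  have h3 : (∫ θ in (0:ℝ)..(2 * Real.pi), starRingEnd ℂ (fa a (circleMap 0 r θ)) * fa a (circleMap 0 r θ))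
      = ((∫ θ in (0:ℝ)..(2 * Real.pi), ‖fa a (circleMap 0 r θ)‖ ^ 2 : ℝ) : ℂ) := by
    rw [← intervalIntegral.integral_ofReal]
    congr 1; ext θ; rw [Complex.conj_mul']; push_cast; rfl
  simp only [h2, h3] at key
  have key2 := (Complex.hasSum_ofReal.1 key).mul_left (2 * Real.pi)⁻¹
  rw [Real.circleAverage_def]
  rw [smul_eq_mul]
  have e : ∀ x : ℝ, (2 * Real.pi)⁻¹ * (2 * Real.pi * x) = x := fun x => by
    have := Real.pi_pos
    field_simp
  simpa only [e] using key2

lemma fa_circle_le (a : H2) (r : ℝ) (h0 : 0 ≤ r) (h1 : r < 1) :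
    Real.circleAverage (fun z => ‖fa a z‖ ^ 2) 0 r ≤ ‖a‖ ^ 2 := by
  refine hasSum_le (fun k => ?_) (fa_parseval a r h0 h1) (H2_norm_sq a)
  have : r ^ (2 * k) ≤ 1 := pow_le_one₀ h0 h1.le
  nlinarith [sq_nonneg ‖a k‖]

lemma norm_sq_le_of_circle (a : H2) (B r₀ : ℝ) (hr₀ : r₀ < 1)
    (h : ∀ r, r₀ < r → 0 ≤ r → r < 1 → Real.circleAverage (fun z => ‖fa a z‖ ^ 2) 0 r ≤ B) :
    ‖a‖ ^ 2 ≤ B := by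
  refine le_of_tendsto (H2_norm_sq a) (Eventually.of_forall fun s => ?_)
  have hc : Tendsto (fun r : ℝ => ∑ k ∈ s, ‖a k‖ ^ 2 * r ^ (2 * k)) (nhdsWithin 1 (Iio 1))
      (nhds (∑ k ∈ s, ‖a k‖ ^ 2 * 1 ^ (2 * k))) := by
    apply Tendsto.mono_left _ nhdsWithin_le_nhds
    apply Continuous.tendsto
    fun_prop
  simp only [one_pow, mul_one] at hc
  refine le_of_tendsto hc ?_
  have h1 : ∀ᶠ r : ℝ in nhdsWithin 1 (Iio 1), max r₀ 0 < r := by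
    apply Filter.Eventually.filter_mono nhdsWithin_le_nhds
    exact lt_mem_nhds (by simp [hr₀])
  filter_upwards [h1, self_mem_nhdsWithin] with r hr hr1
  have h0 : 0 ≤ r := (le_max_right r₀ 0).trans hr.le
  refine le_trans ?_ (h r ((le_max_left _ _).trans_lt hr) h0 hr1)
  exact sum_le_hasSum s (fun k _ => by positivity) (fa_parseval a r h0 hr1)

lemma fa_poisson_majorant (b : H2) (s : ℝ) (hs0 : 0 < s) (hs1 : s < 1) (w : ℂ) (hw : ‖w‖ < s) :
    ‖fa b w‖ ^ 2 ≤ Real.circleAverage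
      ((re ∘ herglotzRieszKernel 0 w) • (fun ξ => ‖fa b ξ‖ ^ 2)) 0 s := by
  have hsub : closure (Metric.ball (0:ℂ) s) ⊆ Metric.ball 0 1 := by
    rw [closure_ball _ hs0.ne']
    exact Metric.closedBall_subset_ball hs1
  have hd : DiffContOnCl ℂ (fun z => fa b z ^ 2) (Metric.ball 0 s) :=
    DifferentiableOn.diffContOnCl (((fa_diff b).pow 2).mono hsub)
  have hw' : w ∈ Metric.ball (0:ℂ) s := by simpa using hw
  have h := hd.circleAverage_re_herglotzRieszKernel_smul hw'
  rw [← norm_pow, ← h, Real.circleAverage_def, Real.circleAverage_def, norm_smul, smul_eq_mul,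
    Real.norm_of_nonneg (by positivity)]
  gcongr
  refine (intervalIntegral.norm_integral_le_integral_norm (by positivity)).trans_eq ?_
  refine intervalIntegral.integral_congr fun θ _ => ?_
  have hp : 0 ≤ (herglotzRieszKernel 0 w (circleMap 0 s θ)).re := by
    have := le_re_herglotzRieszKernel (c := 0) (R := s) (z := circleMap 0 s θ) (w := w)
      (by simp [abs_of_pos hs0]) hw'
    refine le_trans ?_ this
    simp only [sub_zero]
    exact div_nonneg (by linarith) (by positivity)
  simp [abs_of_nonneg hp]

lemma subordination (φ : ℂ → ℂ) (hφ : DifferentiableOn ℂ φ (Metric.ball 0 1))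
    (hm : ∀ z, ‖z‖ < 1 → ‖φ z‖ < 1) (b : H2) (r : ℝ) (hr1 : r < 1)
    (a : ℂ) (ha : ‖a‖ < r) :
    Real.circleAverage (fun z => poissonKernel 0 a z * ‖fa b (φ z)‖ ^ 2) 0 r
      ≤ 4 / (1 - ‖φ a‖) * ‖b‖ ^ 2 := by
  have hr0 : 0 < r := (norm_nonneg a).trans_lt ha
  have hsub : Metric.closedBall (0:ℂ) r ⊆ Metric.ball 0 1 := Metric.closedBall_subset_ball hr1
  -- choose s
  obtain ⟨M, hM1, hM⟩ : ∃ M < 1, ∀ z ∈ Metric.closedBall (0:ℂ) r, ‖φ z‖ ≤ M := by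
    obtain ⟨z₀, hz₀, hmax⟩ := (isCompact_closedBall (0:ℂ) r).exists_isMaxOn
      ⟨0, by simp [hr0.le]⟩ (hφ.continuousOn.mono hsub).norm
    exact ⟨‖φ z₀‖, hm _ (by simpa using hsub hz₀), fun z hz => hmax hz⟩
  have ha1 : ‖φ a‖ < 1 := hm a (ha.trans hr1)
  have ha2 : a ∈ Metric.closedBall (0:ℂ) r := by simpa using ha.le
  have hM0 : 0 ≤ M := (norm_nonneg _).trans (hM a ha2)
  obtain ⟨s, hs, hs1⟩ := exists_between (max_lt hM1 (show (1 + ‖φ a‖) / 2 < 1 by linarith))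
  have hsM : M < s := (le_max_left _ _).trans_lt hs
  have hsa : (1 + ‖φ a‖) / 2 < s := (le_max_right _ _).trans_lt hs
  have hs0 : 0 < s := hM0.trans_lt hsM
  -- the majorant
  set g : ℂ → ℝ := fun ξ => ‖fa b ξ‖ ^ 2 with hg
  have hgc : ContinuousOn g (Metric.sphere 0 |s|) := by
    refine ((fa_cont b).mono ?_).norm.pow 2
    intro z hz
    rw [abs_of_pos hs0] at hz
    simp at hz ⊢; linarith
  have hgi : CircleIntegrable g 0 s := hgc.circleIntegrable'
  have hgi' : CircleIntegrable (fun ξ => (g ξ : ℂ)) 0 s :=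
    (Complex.continuous_ofReal.comp_continuousOn hgc).circleIntegrable'
  set G : ℂ → ℂ := fun w => Real.circleAverage (fun ζ ↦ herglotzRieszKernel 0 w ζ • (g ζ : ℂ)) 0 s
    with hG
  have hGd : DifferentiableOn ℂ G (Metric.ball 0 s) :=
    differentiableOn_circleAverage_herglotzRieszKernel_smul hgi'
  have hGre : ∀ w, ‖w‖ < s → (G w).re
      = Real.circleAverage ((re ∘ herglotzRieszKernel 0 w) • g) 0 s := fun w hw =>
    re_circleAverage_herglotzRieszKernel_smul hgi (by simpa using hw)
  have hmaps : MapsTo φ (Metric.closedBall (0:ℂ) r) (Metric.ball 0 s) := fun z hz => by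
    simpa using (hM z hz).trans_lt hsM
  have hGφ : DifferentiableOn ℂ (fun z => G (φ z)) (Metric.closedBall 0 r) :=
    hGd.comp (hφ.mono hsub) hmaps
  have hd : DiffContOnCl ℂ (fun z => G (φ z)) (Metric.ball 0 r) := by
    apply DifferentiableOn.diffContOnCl
    rwa [closure_ball _ hr0.ne']
  have hP := hd.circleAverage_poissonKernel_smul (w := a) (by simpa using ha)
  have hsph : ∀ z ∈ Metric.sphere (0:ℂ) |r|, z ∈ Metric.closedBall (0:ℂ) r := by
    intro z hz; rw [abs_of_pos hr0] at hz; exact Metric.sphere_subset_closedBall hz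
  have hkc : ContinuousOn (poissonKernel 0 a) (Metric.sphere (0:ℂ) |r|) := by
    unfold poissonKernel
    apply ContinuousOn.div (by fun_prop) (by fun_prop)
    intro z hz h0
    rw [abs_of_pos hr0] at hz
    simp [sub_eq_zero] at h0 hz
    subst h0; linarith
  have hk0 : ∀ z ∈ Metric.sphere (0:ℂ) |r|, 0 ≤ poissonKernel 0 a z := by
    intro z hz
    rw [abs_of_pos hr0] at hz
    simp at hz
    unfold poissonKernel
    simp only [sub_zero]
    refine div_nonneg ?_ (by positivity)
    rw [hz]; nlinarith [norm_nonneg a]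
  have hint1 : CircleIntegrable (poissonKernel 0 a • (fun z => G (φ z))) 0 r := by
    apply ContinuousOn.circleIntegrable'
    exact hkc.smul (hGφ.continuousOn.mono hsph)
  have hre : Real.circleAverage (fun z => poissonKernel 0 a z * (G (φ z)).re) 0 r = (G (φ a)).re := by
    rw [← hP]
    have := Complex.reCLM.circleAverage_comp_comm hint1
    simp only [Complex.reCLM_apply] at this
    rw [← this]
    congr 1; ext z; simp
  calc Real.circleAverage (fun z => poissonKernel 0 a z * ‖fa b (φ z)‖ ^ 2) 0 r
      ≤ Real.circleAverage (fun z => poissonKernel 0 a z * (G (φ z)).re) 0 r := by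
        apply Real.circleAverage_mono
        · apply ContinuousOn.circleIntegrable'
          have hc1 : ContinuousOn (fun z => fa b (φ z)) (Metric.closedBall 0 r) :=
            ContinuousOn.comp (fa_cont b) (hφ.continuousOn.mono hsub)
              (fun z hz => by simpa using hm z (by simpa using hsub hz))
          exact hkc.mul ((hc1.mono hsph).norm.pow 2)
        · apply ContinuousOn.circleIntegrable'
          exact hkc.mul (Complex.continuous_re.comp_continuousOn (hGφ.continuousOn.mono hsph))
        · intro z hz
          have hz' : ‖φ z‖ < s := (hM z (hsph z hz)).trans_lt hsM
          apply mul_le_mul_of_nonneg_left _ (hk0 z hz)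
          rw [hGre _ hz']
          exact fa_poisson_majorant b s hs0 hs1 _ hz'
    _ = (G (φ a)).re := hre
    _ = Real.circleAverage ((re ∘ herglotzRieszKernel 0 (φ a)) • g) 0 s :=
        hGre _ ((hM a ha2).trans_lt hsM)
    _ ≤ Real.circleAverage (fun ξ => 4 / (1 - ‖φ a‖) * g ξ) 0 s := by
        have hwa : φ a ∈ Metric.ball (0:ℂ) s := hmaps ha2
        apply Real.circleAverage_mono
        · apply ContinuousOn.circleIntegrable'
          exact (Complex.continuous_re.comp_continuousOn (continuousOn_herglotzRieszKernel_sphere hwa)).smul hgc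
        · apply ContinuousOn.circleIntegrable'
          exact continuousOn_const.mul hgc
        · intro z hz
          rw [abs_of_pos hs0] at hz
          have h := re_herglotzRieszKernel_le (c := 0) (R := s) hz hwa
          simp only [Pi.smul_apply', Function.comp_apply, smul_eq_mul, herglotzRieszKernel_def]
          apply mul_le_mul_of_nonneg_right _ (by positivity)
          refine h.trans ?_
          simp only [sub_zero]
          rw [div_le_div_iff₀ (by linarith) (by linarith)]
          nlinarith [norm_nonneg (φ a)]
    _ = 4 / (1 - ‖φ a‖) * Real.circleAverage g 0 s := by
        have := Real.circleAverage_fun_smul (f := g) (c := 0) (R := s) (a := 4 / (1 - ‖φ a‖))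
        simpa only [smul_eq_mul] using this
    _ ≤ 4 / (1 - ‖φ a‖) * ‖b‖ ^ 2 := by
        have : 0 ≤ 4 / (1 - ‖φ a‖) := div_nonneg (by norm_num) (by linarith)
        gcongr
        exact fa_circle_le b s hs0.le hs1

/-- The boundary function on the circle. -/
def gU (U : ℝ → ℝ) (ζ : ℂ) : ℝ := U (Complex.arg ζ)

lemma gU_circle (U : ℝ → ℝ) (hp : Function.Periodic U (2 * Real.pi)) (θ : ℝ) :
    gU U (circleMap 0 1 θ) = U θ := by
  unfold gU circleMap
  simp only [ofReal_one, one_mul, zero_add]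
  rw [Complex.arg_exp_mul_I, toIocMod]
  exact hp.sub_zsmul_eq _

lemma circleMap_one (x : ℝ) : circleMap 0 1 x = Complex.exp (x * I) := by
  simp [circleMap]

lemma norm_circle_sub_sq (r θ x : ℝ) :
    ‖circleMap 0 1 x - r * Complex.exp (θ * I)‖ ^ 2 = 1 - 2 * r * Real.cos (θ - x) + r ^ 2 := by
  rw [circleMap_one, ← Complex.normSq_eq_norm_sq, Complex.normSq_apply, Real.cos_sub]
  simp only [Complex.sub_re, Complex.sub_im, Complex.re_ofReal_mul, Complex.im_ofReal_mul,
    Complex.exp_ofReal_mul_I_re, Complex.exp_ofReal_mul_I_im]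
  have h1 := Real.sin_sq_add_cos_sq x
  have h2 := Real.sin_sq_add_cos_sq θ
  linear_combination h1 + r ^ 2 * h2

lemma denom_pos (r y : ℝ) (h0 : 0 ≤ r) (h1 : r < 1) : 0 < 1 - 2 * r * Real.cos y + r ^ 2 := by
  nlinarith [Real.cos_le_one y, sq_nonneg (1 - r)]


lemma gU_integrable {U : ℝ → ℝ} (hc : Continuous U) (hp : Function.Periodic U (2 * Real.pi)) : CircleIntegrable (gU U) 0 1 := by
  unfold CircleIntegrable
  simp only [gU_circle U hp]
  exact hc.intervalIntegrable _ _

lemma gU_integrable' {U : ℝ → ℝ} (hc : Continuous U) (hp : Function.Periodic U (2 * Real.pi)) : CircleIntegrable (fun ζ => (gU U ζ : ℂ)) 0 1 := by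
  unfold CircleIntegrable
  simp only [gU_circle U hp]
  exact (Complex.continuous_ofReal.comp hc).intervalIntegrable _ _

lemma herglotz_re {U : ℝ → ℝ} (hc : Continuous U) (hp : Function.Periodic U (2 * Real.pi)) (r θ : ℝ) (h0 : 0 ≤ r) (h1 : r < 1) :
    (Real.circleAverage (fun ζ ↦ herglotzRieszKernel 0 (r * Complex.exp (θ * I)) ζ • (gU U ζ : ℂ)) 0 1).re
      = poisson U r θ := by
  have hn : ‖(r:ℂ) * Complex.exp (θ * I)‖ = r := by simp [abs_of_nonneg h0]
  rw [re_circleAverage_herglotzRieszKernel_smul (gU_integrable hc hp)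
    (by simpa [abs_of_nonneg h0] using h1), ← poissonKernel_eq_re_herglotzRieszKernel,
    Real.circleAverage_def, poisson]
  simp only [Pi.smul_apply', gU_circle U hp, poissonKernel, sub_zero, smul_eq_mul,
    norm_circle_sub_sq, hn]
  have hper : Function.Periodic
      (fun x : ℝ => (‖circleMap 0 1 x‖ ^ 2 - r ^ 2) / (1 - 2 * r * Real.cos (θ - x) + r ^ 2) * U x)
      (2 * Real.pi) := by
    intro x
    simp only [hp x]
    rw [show θ - (x + 2 * Real.pi) = (θ - x) - 2 * Real.pi by ring, Real.cos_sub_two_pi]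
    simp
  have h2 := hper.intervalIntegral_add_eq 0 (-Real.pi)
  rw [zero_add, show -Real.pi + 2 * Real.pi = Real.pi by ring] at h2
  rw [h2]
  simp only [norm_circleMap_zero, abs_one, one_pow]
  rw [← intervalIntegral.integral_const_mul, ← intervalIntegral.integral_const_mul]
  congr 1; ext x; ring

lemma F_herglotz {U : ℝ → ℝ} (hc : Continuous U) (hp : Function.Periodic U (2 * Real.pi)) (F : ℂ → ℂ) (hF : DifferentiableOn ℂ F (Metric.ball 0 1))
    (hFre : ∀ r θ : ℝ, 0 ≤ r → r < 1 →
      (F ((r : ℂ) * Complex.exp (θ * Complex.I))).re = poisson U r θ) :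
    ∃ k : ℂ, ∀ w, ‖w‖ < 1 → F w =
      Real.circleAverage (fun ζ ↦ herglotzRieszKernel 0 w ζ • (gU U ζ : ℂ)) 0 1 + k := by
  set H : ℂ → ℂ := fun w => Real.circleAverage (fun ζ ↦ herglotzRieszKernel 0 w ζ • (gU U ζ : ℂ)) 0 1
    with hH
  have hHd : DifferentiableOn ℂ H (Metric.ball 0 1) :=
    differentiableOn_circleAverage_herglotzRieszKernel_smul (gU_integrable' hc hp)
  have hA : AnalyticOnNhd ℂ (fun w => F w - H w) (Metric.ball 0 1) :=
    (hF.sub hHd).analyticOnNhd Metric.isOpen_ball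
  have hre : ∀ w ∈ Metric.ball (0:ℂ) 1, (F w - H w).re = 0 := by
    intro w hw
    have hw1 : ‖w‖ < 1 := by simpa using hw
    have e : w = (‖w‖ : ℂ) * Complex.exp (w.arg * I) := (Complex.norm_mul_exp_arg_mul_I w).symm
    rw [Complex.sub_re, sub_eq_zero, e, hFre _ _ (norm_nonneg w) hw1, hH]
    exact (herglotz_re hc hp _ _ (norm_nonneg w) hw1).symm
  obtain ⟨k, hk⟩ := hA.eq_const_of_re_eq_const hre Metric.isOpen_ball
    ⟨⟨0, by simp⟩, (convex_ball (0:ℂ) 1).isPreconnected⟩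
  refine ⟨k, fun w hw => ?_⟩
  have := hk w (show w ∈ Metric.ball (0:ℂ) 1 by simpa using hw)
  rw [← this]; simp [hH]

lemma F_diff_le {U : ℝ → ℝ} (hc : Continuous U) (hp : Function.Periodic U (2 * Real.pi)) (F : ℂ → ℂ) (hF : DifferentiableOn ℂ F (Metric.ball 0 1))
    (hFre : ∀ r θ : ℝ, 0 ≤ r → r < 1 →
      (F ((r : ℂ) * Complex.exp (θ * Complex.I))).re = poisson U r θ)
    (m : ℝ) (z z' : ℂ) (hz : ‖z‖ < 1) (hz' : ‖z'‖ < 1) :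
    ‖F z - F z'‖ ≤ (2 * Real.pi)⁻¹ * ∫ x in (-Real.pi)..Real.pi,
      2 * ‖z - z'‖ / (‖circleMap 0 1 x - z‖ * ‖circleMap 0 1 x - z'‖) * |U x - m| := by
  obtain ⟨k, hk⟩ := F_herglotz hc hp F hF hFre
  have hcirc : ∀ w : ℂ, ‖w‖ < 1 → CircleIntegrable (fun ζ ↦ herglotzRieszKernel 0 w ζ • (gU U ζ : ℂ)) 0 1 :=
    fun w hw => (gU_integrable' hc hp).continuousOn_smul
      (continuousOn_herglotzRieszKernel_sphere (by simpa using hw))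
  have hcirc2 : ∀ w : ℂ, ‖w‖ < 1 → CircleIntegrable (fun ζ ↦ herglotzRieszKernel 0 w ζ • (m : ℂ)) 0 1 :=
    fun w hw => (circleIntegrable_const (m:ℂ) 0 1).continuousOn_smul
      (continuousOn_herglotzRieszKernel_sphere (by simpa using hw))
  -- constants integrate to constants up to an additive constant : use derivative-free identity
  have hconst : ∀ w : ℂ, ‖w‖ < 1 →
      Real.circleAverage (fun ζ ↦ herglotzRieszKernel 0 w ζ • (m : ℂ)) 0 1 = m := by
    intro w hw
    have h1 : Real.circleAverage (fun ζ ↦ ((ζ - 0) / (ζ - w)) • ((m : ℂ))) 0 1 = m :=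
      DiffContOnCl.circleAverage_smul_div (f := fun _ => (m:ℂ)) diffContOnCl_const (by simpa using hw)
    have hne : ∀ ζ ∈ Metric.sphere (0:ℂ) |(1:ℝ)|, ζ - w ≠ 0 := by
      intro ζ hζ h
      have hζ1 : ‖ζ‖ = 1 := by simpa using hζ
      rw [sub_eq_zero.1 h] at hζ1; linarith
    have hI : CircleIntegrable (fun ζ ↦ ((ζ - 0) / (ζ - w)) • ((m : ℂ))) 0 1 := by
      apply ContinuousOn.circleIntegrable'
      exact ContinuousOn.smul (ContinuousOn.div (by fun_prop) (by fun_prop) hne) continuousOn_const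
    have h2 : Real.circleAverage (fun ζ ↦ herglotzRieszKernel 0 w ζ • (m : ℂ)) 0 1
        = Real.circleAverage (fun ζ ↦ (((ζ - 0) / (ζ - w)) • ((m : ℂ)) + ((ζ - 0) / (ζ - w)) • ((m : ℂ))) - (m:ℂ)) 0 1 := by
      apply Real.circleAverage_congr_sphere
      intro ζ hζ
      have := hne ζ hζ
      simp only [herglotzRieszKernel_def, sub_zero, smul_eq_mul]
      field_simp
      ring
    have hI2 : CircleIntegrable (fun ζ ↦ ((ζ - 0) / (ζ - w)) • ((m : ℂ)) + ((ζ - 0) / (ζ - w)) • ((m : ℂ))) 0 1 := hI.add hI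
    rw [h2, Real.circleAverage_fun_sub hI2 (circleIntegrable_const _ _ _),
      Real.circleAverage_fun_add hI hI, h1, Real.circleAverage_const]
    ring
  have hrep : F z - F z' = Real.circleAverage (fun ζ ↦
      (2 * ζ * (z - z') / ((ζ - z) * (ζ - z'))) * ((gU U ζ - m : ℝ) : ℂ)) 0 1 := by
    have e1 : F z - F z' = (Real.circleAverage (fun ζ ↦ herglotzRieszKernel 0 z ζ • (gU U ζ : ℂ)) 0 1
        - Real.circleAverage (fun ζ ↦ herglotzRieszKernel 0 z ζ • (m : ℂ)) 0 1)
        - (Real.circleAverage (fun ζ ↦ herglotzRieszKernel 0 z' ζ • (gU U ζ : ℂ)) 0 1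
        - Real.circleAverage (fun ζ ↦ herglotzRieszKernel 0 z' ζ • (m : ℂ)) 0 1) := by
      rw [hconst z hz, hconst z' hz', hk z hz, hk z' hz']; ring
    have q1 : CircleIntegrable (fun ζ ↦ herglotzRieszKernel 0 z ζ • (gU U ζ : ℂ) - herglotzRieszKernel 0 z ζ • (m : ℂ)) 0 1 :=
      (hcirc z hz).sub (hcirc2 z hz)
    have q2 : CircleIntegrable (fun ζ ↦ herglotzRieszKernel 0 z' ζ • (gU U ζ : ℂ) - herglotzRieszKernel 0 z' ζ • (m : ℂ)) 0 1 :=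
      (hcirc z' hz').sub (hcirc2 z' hz')
    rw [e1, ← Real.circleAverage_fun_sub (hcirc z hz) (hcirc2 z hz),
      ← Real.circleAverage_fun_sub (hcirc z' hz') (hcirc2 z' hz'),
      ← Real.circleAverage_fun_sub q1 q2]
    apply Real.circleAverage_congr_sphere
    intro ζ hζ
    have hζ1 : ‖ζ‖ = 1 := by simpa using hζ
    have n1 : ζ - z ≠ 0 := fun h => by rw [sub_eq_zero.1 h] at hζ1; linarith
    have n2 : ζ - z' ≠ 0 := fun h => by rw [sub_eq_zero.1 h] at hζ1; linarith
    simp only [herglotzRieszKernel_def, sub_zero, smul_eq_mul]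
    push_cast
    field_simp
    ring
  rw [hrep, Real.circleAverage_def, norm_smul, Real.norm_of_nonneg (by positivity)]
  gcongr
  refine (intervalIntegral.norm_integral_le_integral_norm (by positivity)).trans_eq ?_
  have hper : Function.Periodic (fun x : ℝ => 
      2 * ‖z - z'‖ / (‖circleMap 0 1 x - z‖ * ‖circleMap 0 1 x - z'‖) * |U x - m|) (2 * Real.pi) := by
    intro x
    simp only [hp x, periodic_circleMap 0 1 x]
  have h2 := hper.intervalIntegral_add_eq 0 (-Real.pi)
  rw [zero_add, show -Real.pi + 2 * Real.pi = Real.pi by ring] at h2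
  rw [← h2]
  refine intervalIntegral.integral_congr fun θ _ => ?_
  simp only [gU_circle U hp, norm_mul, norm_div, Complex.norm_real, Real.norm_eq_abs]
  simp

lemma D_upper (r y : ℝ) (h0 : 0 ≤ r) (h1 : r ≤ 1) :
    1 - 2 * r * Real.cos y + r ^ 2 ≤ (1 - r) ^ 2 + y ^ 2 := by
  have := Real.one_sub_sq_div_two_le_cos (x := y)
  nlinarith [sq_nonneg y]

lemma D_lower (r y : ℝ) (h0 : 1 / 2 ≤ r) (h1 : r ≤ 1) (hy : |y| ≤ Real.pi) :
    ((1 - r) ^ 2 + y ^ 2) / 5 ≤ 1 - 2 * r * Real.cos y + r ^ 2 := by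
  have h := Real.cos_le_one_sub_mul_cos_sq hy
  have hpi := Real.pi_lt_d2
  have hpi0 := Real.pi_pos
  have h2 : 2 / Real.pi ^ 2 ≥ 1 / 5 := by
    rw [ge_iff_le, div_le_div_iff₀ (by norm_num) (by positivity)]; nlinarith
  have h3 : y ^ 2 / 5 ≤ 2 / Real.pi ^ 2 * y ^ 2 := by nlinarith [sq_nonneg y]
  nlinarith [sq_nonneg (1 - r), sq_nonneg y]

lemma U_nonneg {U : ℝ → ℝ} (hK : ClassU U) (x : ℝ) (hx : x ∈ Icc (-Real.pi) Real.pi) : 0 ≤ U x := by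
  obtain ⟨hc, he, hp, h0, hm, hpos, ht⟩ := hK
  rcases lt_trichotomy x 0 with h | h | h
  · rw [← he]; exact (hpos _ (by linarith) (by linarith [hx.1])).le
  · rw [h, h0]
  · exact (hpos _ h hx.2).le

lemma poisson_integrand_cont {U : ℝ → ℝ} (hc : Continuous U) (r θ : ℝ) (h0 : 0 ≤ r) (h1 : r < 1) :
    Continuous (fun x => U x / (1 - 2 * r * Real.cos (θ - x) + r ^ 2)) := by
  apply Continuous.div hc (by fun_prop)
  intro x; exact (denom_pos r _ h0 h1).ne'

lemma poisson_even {U : ℝ → ℝ} (he : ∀ t, U (-t) = U t) (r θ : ℝ) :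
    poisson U r (-θ) = poisson U r θ := by
  unfold poisson
  congr 1
  have := intervalIntegral.integral_comp_neg (a := -Real.pi) (b := Real.pi)
    (fun x => U x / (1 - 2 * r * Real.cos (θ - x) + r ^ 2))
  rw [neg_neg] at this
  rw [← this]
  congr 1; ext x
  rw [he, ← Real.cos_neg]; ring_nf

/-- lower bound by restricting the integral -/
lemma poisson_ge {U : ℝ → ℝ} (hK : ClassU U) (r θ a b : ℝ) (g : ℝ → ℝ) (h0 : 0 ≤ r) (h1 : r < 1)
    (ha : -Real.pi ≤ a) (hab : a ≤ b) (hb : b ≤ Real.pi)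
    (hgi : IntervalIntegrable g volume a b)
    (hg : ∀ x ∈ Icc a b, g x ≤ U x / (1 - 2 * r * Real.cos (θ - x) + r ^ 2)) :
    (1 - r) / (2 * Real.pi) * ∫ x in a..b, g x ≤ poisson U r θ := by
  have hpi := Real.pi_pos
  have hcont := poisson_integrand_cont hK.1 r θ h0 h1
  set f := fun x => U x / (1 - 2 * r * Real.cos (θ - x) + r ^ 2) with hf
  have hfn : ∀ x ∈ Icc (-Real.pi) Real.pi, 0 ≤ f x := fun x hx =>
    div_nonneg (U_nonneg hK x hx) (denom_pos r _ h0 h1).le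
  have s1 : ∫ x in a..b, g x ≤ ∫ x in a..b, f x :=
    intervalIntegral.integral_mono_on hab hgi (hcont.intervalIntegrable _ _) hg
  have s2 : ∫ x in a..b, f x ≤ ∫ x in (-Real.pi)..Real.pi, f x := by
    apply intervalIntegral.integral_mono_interval ha hab hb _ (hcont.intervalIntegrable _ _)
    refine (ae_restrict_iff' measurableSet_Ioc).2 (ae_of_all _ fun x hx => hfn x ⟨hx.1.le, hx.2⟩)
  have s3 : 0 ≤ ∫ x in (-Real.pi)..Real.pi, f x :=
    intervalIntegral.integral_nonneg (by linarith) hfn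
  unfold poisson
  calc (1 - r) / (2 * Real.pi) * ∫ x in a..b, g x
      ≤ (1 - r) / (2 * Real.pi) * ∫ x in (-Real.pi)..Real.pi, f x := by
        apply mul_le_mul_of_nonneg_left (s1.trans s2); apply div_nonneg <;> linarith
    _ ≤ _ := by
        apply mul_le_mul_of_nonneg_right _ s3
        apply div_le_div_of_nonneg_right _ (by positivity)
        nlinarith

lemma poisson_lower1 {U : ℝ → ℝ} (hK : ClassU U) (r θ : ℝ) (h0 : 0 ≤ r) (h1 : r < 1)
    (ha : 0 ≤ θ - (1 - r)) (hb : θ ≤ Real.pi) :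
    U (θ - (1 - r)) / (4 * Real.pi) ≤ poisson U r θ := by
  have hpi := Real.pi_pos
  have h := poisson_ge hK r θ (θ - (1 - r)) θ (fun _ => U (θ - (1 - r)) / (2 * (1 - r) ^ 2)) h0 h1
    (by linarith) (by linarith) hb (by simp) ?_
  · refine le_trans (le_of_eq ?_) h
    rw [intervalIntegral.integral_const, smul_eq_mul]
    have : 1 - r ≠ 0 := by linarith
    field_simp
    ring
  · intro x hx
    have hx0 : 0 ≤ x := ha.trans hx.1
    have hU0 : 0 ≤ U (θ - (1 - r)) := U_nonneg hK _ ⟨by linarith, by linarith⟩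
    apply div_le_div₀ (U_nonneg hK _ ⟨by linarith, hx.2.trans hb⟩)
    · exact hK.2.2.2.2.1 ⟨ha, by linarith⟩ ⟨hx0, hx.2.trans hb⟩ hx.1
    · exact denom_pos r _ h0 h1
    · refine (D_upper r _ h0 h1.le).trans ?_
      have : (θ - x) ^ 2 ≤ (1 - r) ^ 2 := by
        apply pow_le_pow_left₀ <;> linarith [hx.1, hx.2]
      linarith

lemma poisson_pos {U : ℝ → ℝ} (hK : ClassU U) (r θ : ℝ) (h0 : 0 ≤ r) (h1 : r < 1) :
    0 < poisson U r θ := by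
  have hpi := Real.pi_pos
  have hU1 : 0 < U 1 := hK.2.2.2.2.2.1 1 (by norm_num) (by linarith [Real.pi_gt_three])
  have h := poisson_ge hK r θ 1 2 (fun _ => U 1 / 4) h0 h1
    (by linarith) (by linarith) (by linarith [Real.pi_gt_three]) (by simp) ?_
  · refine lt_of_lt_of_le ?_ h
    rw [intervalIntegral.integral_const, smul_eq_mul]
    have : 0 < 1 - r := by linarith
    norm_num
    positivity
  · intro x hx
    have hx2 : x ≤ Real.pi := by linarith [Real.pi_gt_three, hx.2]
    apply div_le_div₀ (U_nonneg hK _ ⟨by linarith [hx.1], hx2⟩)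
    · exact hK.2.2.2.2.1 ⟨by norm_num, by linarith [Real.pi_gt_three]⟩ ⟨by linarith [hx.1], hx2⟩ hx.1
    · exact denom_pos r _ h0 h1
    · nlinarith [Real.neg_one_le_cos (θ - x)]

lemma h_integrable {U : ℝ → ℝ} (hK : ClassU U) (a b : ℝ) (ha : 0 < a) (hb : 0 < b) :
    IntervalIntegrable (fun x => U x / x ^ 2) volume a b := by
  apply ContinuousOn.intervalIntegrable
  apply ContinuousOn.div hK.1.continuousOn (by fun_prop)
  intro x hx
  have : 0 < x := lt_of_lt_of_le (lt_min ha hb) hx.1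
  positivity

lemma poisson_lower2 {U : ℝ → ℝ} (hK : ClassU U) (δ : ℝ) (h0 : 0 < δ) (h1 : δ ≤ 1) :
    δ * hU U δ / (4 * Real.pi) ≤ poisson U (1 - δ) 0 := by
  have hpi := Real.pi_pos
  have hpi3 := Real.pi_gt_three
  have h := poisson_ge hK (1 - δ) 0 δ Real.pi (fun x => 1 / 2 * (U x / x ^ 2)) (by linarith) (by linarith)
    (by linarith) (by linarith) le_rfl ((h_integrable hK _ _ h0 hpi).const_mul _) ?_
  · refine le_trans (le_of_eq ?_) h
    rw [intervalIntegral.integral_const_mul, ← hU]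
    field_simp
    ring
  · intro x hx
    have hx0 : 0 < x := h0.trans_le hx.1
    rw [show 1 / 2 * (U x / x ^ 2) = U x / (2 * x ^ 2) by field_simp]
    apply div_le_div_of_nonneg_left (U_nonneg hK _ ⟨by linarith, hx.2⟩)
    · exact denom_pos _ _ (by linarith) (by linarith)
    · refine (D_upper _ _ (by linarith) (by linarith)).trans ?_
      nlinarith [hx.1]

lemma poisson_upper {U : ℝ → ℝ} (hK : ClassU U) (δ : ℝ) (h0 : 0 < δ) (h1 : δ ≤ 1 / 2) :
    poisson U (1 - δ) 0 ≤ 4 * (U δ + δ * hU U δ) := by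
  have hpi := Real.pi_pos
  have hpi3 := Real.pi_gt_three
  have hcont := poisson_integrand_cont hK.1 (1 - δ) 0 (by linarith) (by linarith)
  set f := fun x => U x / (1 - 2 * (1 - δ) * Real.cos (0 - x) + (1 - δ) ^ 2) with hf
  have hsym : ∫ x in (-Real.pi)..0, f x = ∫ x in 0..Real.pi, f x := by
    have := intervalIntegral.integral_comp_neg (a := 0) (b := Real.pi) f
    rw [neg_zero] at this
    rw [← this]
    congr 1; ext x
    simp only [hf, hK.2.1, zero_sub, neg_neg, Real.cos_neg]
  have hsplit : ∫ x in (-Real.pi)..Real.pi, f x = 2 * ((∫ x in 0..δ, f x) + ∫ x in δ..Real.pi, f x) := by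
    rw [intervalIntegral.integral_add_adjacent_intervals (hcont.intervalIntegrable _ _)
      (hcont.intervalIntegrable _ _), ← intervalIntegral.integral_add_adjacent_intervals
      (b := 0) (hcont.intervalIntegrable _ _) (hcont.intervalIntegrable _ _), hsym]; ring
  have hlow : ∀ x ∈ Icc 0 Real.pi, (δ ^ 2 + x ^ 2) / 5 ≤
      1 - 2 * (1 - δ) * Real.cos (0 - x) + (1 - δ) ^ 2 := by
    intro x hx
    have := D_lower (1 - δ) (0 - x) (by linarith) (by linarith) (by rw [abs_le]; constructor <;> linarith [hx.1, hx.2])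
    refine le_trans (le_of_eq ?_) this
    ring
  have i1 : ∫ x in 0..δ, f x ≤ ∫ x in 0..δ, 5 * U δ / δ ^ 2 := by
    apply intervalIntegral.integral_mono_on h0.le (hcont.intervalIntegrable _ _) (by simp)
    intro x hx
    have hxp : x ∈ Icc 0 Real.pi := ⟨hx.1, by linarith [hx.2]⟩
    have hm := hK.2.2.2.2.1 hxp ⟨h0.le, by linarith⟩ hx.2
    have hUx := U_nonneg hK x ⟨by linarith [hx.1], hxp.2⟩
    have : f x ≤ U δ / (δ ^ 2 / 5) := by
      apply div_le_div₀ (hUx.trans hm) hm (by positivity)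
      refine le_trans ?_ (hlow x hxp)
      nlinarith [sq_nonneg x]
    refine this.trans (le_of_eq ?_); field_simp
  have i2 : ∫ x in δ..Real.pi, f x ≤ ∫ x in δ..Real.pi, 5 * (U x / x ^ 2) := by
    apply intervalIntegral.integral_mono_on (by linarith) (hcont.intervalIntegrable _ _)
      ((h_integrable hK _ _ h0 hpi).const_mul _)
    intro x hx
    have hx0 : 0 < x := h0.trans_le hx.1
    have hxp : x ∈ Icc 0 Real.pi := ⟨hx0.le, hx.2⟩
    have hUx := U_nonneg hK x ⟨by linarith [hx.1], hxp.2⟩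
    have : f x ≤ U x / (x ^ 2 / 5) := by
      apply div_le_div_of_nonneg_left hUx (by positivity)
      refine le_trans ?_ (hlow x hxp)
      nlinarith [sq_nonneg δ]
    refine this.trans (le_of_eq ?_); field_simp
  rw [intervalIntegral.integral_const, smul_eq_mul] at i1
  rw [intervalIntegral.integral_const_mul, ← hU] at i2
  have hUd := U_nonneg hK δ ⟨by linarith, by linarith⟩
  have hh : 0 ≤ hU U δ := by
    unfold hU
    apply intervalIntegral.integral_nonneg (by linarith)
    intro x hx
    exact div_nonneg (U_nonneg hK x ⟨by linarith [hx.1], hx.2⟩) (by positivity)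
  unfold poisson
  rw [hsplit]
  have e1 : (δ - 0) * (5 * U δ / δ ^ 2) = 5 * U δ / δ := by field_simp; ring
  rw [e1] at i1
  calc (1 - (1 - δ) ^ 2) / (2 * Real.pi) * (2 * ((∫ x in 0..δ, f x) + ∫ x in δ..Real.pi, f x))
      ≤ (2 * δ) / (2 * 3) * (2 * (5 * U δ / δ + 5 * hU U δ)) := by
        apply mul_le_mul
        · apply div_le_div₀ (by positivity) (by nlinarith) (by positivity) (by linarith)
        · linarith
        · have : 0 ≤ ∫ x in (-Real.pi)..Real.pi, f x := by
            apply intervalIntegral.integral_nonneg (by linarith)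
            intro x hx
            exact div_nonneg (U_nonneg hK x hx) (denom_pos _ _ (by linarith) (by linarith)).le
          linarith [hsplit]
        · positivity
    _ = 10 / 3 * (U δ + δ * hU U δ) := by field_simp; ring
    _ ≤ _ := by
        have : 0 ≤ U δ + δ * hU U δ := by positivity
        linarith

lemma int_inv_abs (ℓ : ℝ) (h0 : 0 < ℓ) (h1 : ℓ ≤ 1 / 2) :
    ∫ y in (-Real.pi)..Real.pi, 4 / (ℓ + |y|) ≤ 8 * Real.log (5 / ℓ) := by
  have hpi := Real.pi_pos
  have hcont : Continuous (fun y : ℝ => 4 / (ℓ + |y|)) := by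
    apply Continuous.div (by fun_prop) (by fun_prop)
    intro x; positivity
  have hsym : ∫ x in (-Real.pi)..0, 4 / (ℓ + |x|) = ∫ x in 0..Real.pi, 4 / (ℓ + |x|) := by
    have := intervalIntegral.integral_comp_neg (a := 0) (b := Real.pi) (fun y : ℝ => 4 / (ℓ + |y|))
    rw [neg_zero] at this
    rw [← this]
    congr 1; ext x
    rw [abs_neg]
  rw [← intervalIntegral.integral_add_adjacent_intervals
      (b := 0) (hcont.intervalIntegrable _ _) (hcont.intervalIntegrable _ _), hsym]
  have e : ∫ x in 0..Real.pi, 4 / (ℓ + |x|) = 4 * Real.log ((Real.pi + ℓ) / ℓ) := by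
    have e1 : ∫ x in 0..Real.pi, 4 / (ℓ + |x|) = ∫ x in 0..Real.pi, (fun y => 4 * y⁻¹) (x + ℓ) := by
      apply intervalIntegral.integral_congr
      intro x hx
      rw [uIcc_of_le hpi.le] at hx
      simp only [abs_of_nonneg hx.1, div_eq_mul_inv, add_comm]
    rw [e1, intervalIntegral.integral_comp_add_right (f := fun y => 4 * y⁻¹), intervalIntegral.integral_const_mul,
      integral_inv_of_pos (by linarith) (by linarith), zero_add]
  rw [e]
  have : Real.log ((Real.pi + ℓ) / ℓ) ≤ Real.log (5 / ℓ) := by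
    apply Real.log_le_log (by positivity)
    gcongr; linarith [Real.pi_lt_d2]
  linarith

lemma inv_norm_cont (z : ℂ) (hz : ‖z‖ < 1) : Continuous (fun x : ℝ => 1 / ‖circleMap 0 1 x - z‖) := by
  apply Continuous.div (by fun_prop)
  · exact ((continuous_circleMap 0 1).sub continuous_const).norm
  · intro x h
    rw [norm_eq_zero, sub_eq_zero] at h
    rw [← h] at hz; simp at hz

lemma int_inv_bound (ℓ τ : ℝ) (h0 : 0 < ℓ) (h1 : ℓ ≤ 1 / 2) :
    ∫ x in (-Real.pi)..Real.pi, 1 / ‖circleMap 0 1 x - ((1 - ℓ : ℝ) : ℂ) * Complex.exp (τ * I)‖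
      ≤ 8 * Real.log (5 / ℓ) := by
  have hpi := Real.pi_pos
  refine le_trans ?_ (int_inv_abs ℓ h0 h1)
  have hn : ∀ x, ‖circleMap 0 1 x - ((1 - ℓ : ℝ) : ℂ) * Complex.exp (τ * I)‖
      = Real.sqrt (1 - 2 * (1 - ℓ) * Real.cos (τ - x) + (1 - ℓ) ^ 2) := fun x => by
    rw [← norm_circle_sub_sq, Real.sqrt_sq (norm_nonneg _)]
  simp only [hn]
  set g : ℝ → ℝ := fun y => 1 / Real.sqrt (1 - 2 * (1 - ℓ) * Real.cos y + (1 - ℓ) ^ 2) with hg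
  have hgc : Continuous g := by
    apply Continuous.div (by fun_prop) (by fun_prop)
    intro x
    exact (Real.sqrt_pos.2 (denom_pos _ _ (by linarith) (by linarith))).ne'
  have hgp : Function.Periodic g (2 * Real.pi) := by
    intro y; simp only [hg, Real.cos_add_two_pi]
  have e1 : ∫ x in (-Real.pi)..Real.pi, g (τ - x) = ∫ x in (-Real.pi)..Real.pi, g x := by
    rw [intervalIntegral.integral_comp_sub_left]
    have := hgp.intervalIntegral_add_eq (τ - Real.pi) (-Real.pi)
    rw [show τ - Real.pi + 2 * Real.pi = τ - -Real.pi by ring,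
      show -Real.pi + 2 * Real.pi = Real.pi by ring] at this
    exact this
  change ∫ x in (-Real.pi)..Real.pi, g (τ - x) ≤ _
  rw [e1]
  apply intervalIntegral.integral_mono_on (by linarith) (hgc.intervalIntegrable _ _)
  · apply Continuous.intervalIntegrable
    apply Continuous.div (by fun_prop) (by fun_prop)
    intro x; positivity
  · intro x hx
    have hx' : |x| ≤ Real.pi := abs_le.2 ⟨hx.1, hx.2⟩
    have hD := D_lower (1 - ℓ) x (by linarith) (by linarith) hx'
    have hs : (ℓ + |x|) / 4 ≤ Real.sqrt (1 - 2 * (1 - ℓ) * Real.cos x + (1 - ℓ) ^ 2) := by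
      apply Real.le_sqrt_of_sq_le
      refine le_trans ?_ hD
      rw [sub_sub_cancel]
      nlinarith [sq_nonneg (ℓ - |x|), sq_abs x, sq_nonneg ℓ, sq_nonneg x]
    simp only [hg]
    rw [show 4 / (ℓ + |x|) = 1 / ((ℓ + |x|) / 4) by rw [one_div_div]]
    apply one_div_le_one_div_of_le (by positivity) hs

lemma F_diff_main {U : ℝ → ℝ} (hc : Continuous U) (hp : Function.Periodic U (2 * Real.pi))
    (F : ℂ → ℂ) (hF : DifferentiableOn ℂ F (Metric.ball 0 1))
    (hFre : ∀ r θ : ℝ, 0 ≤ r → r < 1 →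
      (F ((r : ℂ) * Complex.exp (θ * Complex.I))).re = poisson U r θ)
    (B r θ ℓ τ : ℝ) (h0 : 0 ≤ r) (h1 : r < 1) (hℓ0 : 0 < ℓ) (hℓ1 : ℓ ≤ 1 / 2)
    (hB0 : 0 ≤ B)
    (hB : ∀ x ∈ Icc (-Real.pi) Real.pi, |U x - U θ| ≤ B * ‖circleMap 0 1 x - circleMap 0 1 θ‖) :
    ‖F ((r : ℂ) * Complex.exp (θ * I)) - F (((1 - ℓ : ℝ) : ℂ) * Complex.exp (τ * I))‖ ≤
      6 * B * ‖(r : ℂ) * Complex.exp (θ * I) - ((1 - ℓ : ℝ) : ℂ) * Complex.exp (τ * I)‖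
        * Real.log (5 / ℓ) := by
  have hpi := Real.pi_pos
  set z := (r : ℂ) * Complex.exp (θ * I) with hz
  set z' := ((1 - ℓ : ℝ) : ℂ) * Complex.exp (τ * I) with hz'
  have nz : ‖z‖ = r := by simp [hz, abs_of_nonneg h0]
  have nz' : ‖z'‖ = 1 - ℓ := by
    rw [hz', norm_mul, Complex.norm_exp_ofReal_mul_I, Complex.norm_real, Real.norm_of_nonneg (by linarith), mul_one]
  have hz1 : ‖z‖ < 1 := by rw [nz]; exact h1
  have hz1' : ‖z'‖ < 1 := by rw [nz']; linarith
  have hd := F_diff_le hc hp F hF hFre (U θ) z z' hz1 hz1'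
  have hpos : ∀ w : ℂ, ‖w‖ < 1 → ∀ x : ℝ, 0 < ‖circleMap 0 1 x - w‖ := by
    intro w hw x
    rw [norm_pos_iff]
    intro h
    rw [sub_eq_zero] at h
    rw [← h] at hw; simp at hw
  have hkey : ∀ x ∈ Icc (-Real.pi) Real.pi,
      2 * ‖z - z'‖ / (‖circleMap 0 1 x - z‖ * ‖circleMap 0 1 x - z'‖) * |U x - U θ|
        ≤ 4 * B * ‖z - z'‖ * (1 / ‖circleMap 0 1 x - z'‖) := by
    intro x hx
    have p1 := hpos z hz1 x
    have p2 := hpos z' hz1' x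
    have t1 : ‖circleMap 0 1 θ - z‖ = 1 - r := by
      rw [circleMap_one, hz, show Complex.exp (θ * I) - r * Complex.exp (θ * I)
        = ((1 - r : ℝ) : ℂ) * Complex.exp (θ * I) by push_cast; ring, norm_mul,
        Complex.norm_exp_ofReal_mul_I, Complex.norm_real, Real.norm_of_nonneg (by linarith), mul_one]
    have t2 : 1 - r ≤ ‖circleMap 0 1 x - z‖ := by
      have := norm_sub_norm_le (circleMap 0 1 x) z
      rw [nz] at this
      simpa using this
    have t3 : ‖circleMap 0 1 x - circleMap 0 1 θ‖ ≤ 2 * ‖circleMap 0 1 x - z‖ := by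
      have := norm_sub_le_norm_sub_add_norm_sub (circleMap 0 1 x) z (circleMap 0 1 θ)
      rw [norm_sub_rev z] at this
      linarith
    have t4 : |U x - U θ| ≤ B * (2 * ‖circleMap 0 1 x - z‖) :=
      (hB x hx).trans (mul_le_mul_of_nonneg_left t3 hB0)
    calc _ ≤ 2 * ‖z - z'‖ / (‖circleMap 0 1 x - z‖ * ‖circleMap 0 1 x - z'‖) *
          (B * (2 * ‖circleMap 0 1 x - z‖)) := by gcongr
      _ = _ := by field_simp; ring
  have hI := int_inv_bound ℓ τ hℓ0 hℓ1
  have hcont : Continuous (fun x => 2 * ‖z - z'‖ / (‖circleMap 0 1 x - z‖ * ‖circleMap 0 1 x - z'‖) * |U x - U θ|) := by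
    apply Continuous.mul _ (by fun_prop)
    apply Continuous.div continuous_const
    · exact (((continuous_circleMap 0 1).sub continuous_const).norm).mul
        (((continuous_circleMap 0 1).sub continuous_const).norm)
    · intro x; exact (mul_pos (hpos z hz1 x) (hpos z' hz1' x)).ne'
  have hI2 : ∫ x in (-Real.pi)..Real.pi,
      2 * ‖z - z'‖ / (‖circleMap 0 1 x - z‖ * ‖circleMap 0 1 x - z'‖) * |U x - U θ|
      ≤ 4 * B * ‖z - z'‖ * (8 * Real.log (5 / ℓ)) := by
    calc _ ≤ ∫ x in (-Real.pi)..Real.pi, 4 * B * ‖z - z'‖ * (1 / ‖circleMap 0 1 x - z'‖) := by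
          apply intervalIntegral.integral_mono_on (by linarith) (hcont.intervalIntegrable _ _)
            (((inv_norm_cont z' hz1').intervalIntegrable _ _).const_mul _) hkey
      _ ≤ _ := by
          rw [intervalIntegral.integral_const_mul]
          gcongr
  have hlog : 0 ≤ Real.log (5 / ℓ) := by
    apply Real.log_nonneg
    rw [le_div_iff₀ hℓ0]; linarith
  calc _ ≤ _ := hd
    _ ≤ (2 * Real.pi)⁻¹ * (4 * B * ‖z - z'‖ * (8 * Real.log (5 / ℓ))) := by gcongr
    _ = (16 / Real.pi) * (B * ‖z - z'‖ * Real.log (5 / ℓ)) := by field_simp; ring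
    _ ≤ 6 * (B * ‖z - z'‖ * Real.log (5 / ℓ)) := by
        gcongr
        rw [div_le_iff₀ hpi]; linarith [Real.pi_gt_three]
    _ = _ := by ring

lemma h_hasDeriv {U : ℝ → ℝ} (hK : ClassU U) (t : ℝ) (h0 : 0 < t) :
    HasDerivAt (hU U) (-(U t / t ^ 2)) t := by
  unfold hU
  apply intervalIntegral.integral_hasDerivAt_left (h_integrable hK _ _ h0 Real.pi_pos)
  · have hc : ContinuousOn (fun x => U x / x ^ 2) (Ioi 0) := by
      apply ContinuousOn.div hK.1.continuousOn (by fun_prop)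
      intro x hx; have : 0 < x := hx; positivity
    exact hc.stronglyMeasurableAtFilter isOpen_Ioi t h0
  · apply ContinuousAt.div hK.1.continuousAt (by fun_prop); positivity

lemma h_anti {U : ℝ → ℝ} (hK : ClassU U) (s t : ℝ) (h0 : 0 < s) (hst : s ≤ t) (ht : t ≤ Real.pi) :
    hU U t ≤ hU U s := by
  unfold hU
  rw [← intervalIntegral.integral_add_adjacent_intervals (b := t)
    (h_integrable hK _ _ h0 (by linarith)) (h_integrable hK _ _ (by linarith) Real.pi_pos)]
  have : 0 ≤ ∫ x in s..t, U x / x ^ 2 := by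
    apply intervalIntegral.integral_nonneg hst
    intro x hx
    exact div_nonneg (U_nonneg hK x ⟨by linarith [hx.1, Real.pi_pos], hx.2.trans ht⟩) (by positivity)
  linarith

/-- The function `L ↦ h(e^{-L})`. -/
def HL (U : ℝ → ℝ) (L : ℝ) : ℝ := hU U (Real.exp (-L))

lemma HL_deriv {U : ℝ → ℝ} (hK : ClassU U) (L : ℝ) :
    HasDerivAt (HL U) (U (Real.exp (-L)) / Real.exp (-L)) L := by
  have h1 : HasDerivAt (fun L : ℝ => Real.exp (-L)) (Real.exp (-L) * (-1)) L :=
    ((hasDerivAt_id L).neg).exp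
  have := (h_hasDeriv hK (Real.exp (-L)) (Real.exp_pos _)).comp L h1
  have h3 : Real.exp (-L) ≠ 0 := (Real.exp_pos (-L)).ne'
  have e : U (Real.exp (-L)) / Real.exp (-L)
      = -(U (Real.exp (-L)) / Real.exp (-L) ^ 2) * (Real.exp (-L) * -1) := by
    field_simp
  rw [e]
  exact this

lemma exp_neg_lt_one {L : ℝ} (h : 0 < L) : Real.exp (-L) < 1 := by
  rw [Real.exp_lt_one_iff]; linarith

lemma HL_mono {U : ℝ → ℝ} (hK : ClassU U) (L L' : ℝ) (h0 : 0 ≤ L) (h : L ≤ L') : HL U L ≤ HL U L' := by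
  apply h_anti hK _ _ (Real.exp_pos _)
  · apply Real.exp_le_exp.2; linarith
  · have : Real.exp (-L) ≤ 1 := Real.exp_le_one_iff.2 (by linarith)
    linarith [Real.pi_gt_three]

lemma HL_tendsto {U : ℝ → ℝ} (hK : ClassU U) : Tendsto (HL U) atTop atTop := by
  have h := hK.2.2.2.2.2.2
  refine h.comp ?_
  rw [tendsto_nhdsWithin_iff]
  refine ⟨Real.tendsto_exp_neg_atTop_nhds_zero, Eventually.of_forall fun x => Real.exp_pos _⟩

structure Analytic1 (U : ℝ → ℝ) (L₁ K C : ℝ) (p : ℕ) : Prop where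
  hC : 0 < C
  hL : 3 ≤ L₁
  hK1 : 1 ≤ K
  one_le : ∀ L, L₁ ≤ L → 1 ≤ HL U L
  power : ∀ q L L', 1 ≤ q → L₁ ≤ L → L ≤ L' → L' ≤ L ^ q → HL U L' ≤ q ^ C * HL U L
  lin : ∀ L, L₁ ≤ L → HL U L ≤ K * L
  Ule : ∀ L, L₁ ≤ L → U (Real.exp (-L)) ≤ Real.exp (-L) * HL U L
  Uge : ∀ L, L₁ ≤ L → Real.exp (-L) ≤ K * L ^ p * U (Real.exp (-L))
  lip : ∀ a b, 0 < a → a ≤ b → b ≤ Real.exp (-L₁) → U b - U a ≤ K * hU U a * (b - a)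

lemma analytic1 (U U' : ℝ → ℝ) (hK : ClassU U)
    (hderiv : ∀ t ∈ Set.Ioc (0 : ℝ) Real.pi, HasDerivAt U (U' t) t)
    (c C t₀ : ℝ) (hc : 1 < c) (hC : 0 < C) (ht₀ : 0 < t₀ ∧ t₀ < 1)
    (hcond : ∀ t : ℝ, 0 < t → t < t₀ →
      t * U' t / U t ≤ 1 + c / |Real.log t| ∧
      U t / (t * hU U t) ≤ C / (|Real.log t| * Real.log |Real.log t|)) :
    ∃ L₁ K : ℝ, ∃ p : ℕ, Analytic1 U L₁ K C p := by
  have hpi := Real.pi_gt_three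
  obtain ⟨L₂, hL₂⟩ := (tendsto_atTop.1 (HL_tendsto hK) 1).exists_forall_of_atTop
  obtain ⟨L₁, hL1⟩ : ∃ L₁ : ℝ, L₁ = max (max 3 L₂) (max C (-Real.log t₀ + 1)) := ⟨_, rfl⟩
  have b3 : 3 ≤ L₁ := by rw [hL1]; exact (le_max_left _ _).trans (le_max_left _ _)
  have b2 : L₂ ≤ L₁ := by rw [hL1]; exact (le_max_right _ _).trans (le_max_left _ _)
  have bC : C ≤ L₁ := by rw [hL1]; exact (le_max_left _ _).trans (le_max_right _ _)
  have b0 : -Real.log t₀ + 1 ≤ L₁ := by rw [hL1]; exact (le_max_right _ _).trans (le_max_right _ _)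
  clear hL1
  have hlog1 : ∀ L : ℝ, L₁ ≤ L → 1 ≤ Real.log L := by
    intro L hL
    rw [Real.le_log_iff_exp_le (by linarith)]
    linarith [Real.exp_one_lt_d9]
  have hone : ∀ L, L₁ ≤ L → 1 ≤ HL U L := fun L hL => hL₂ L (b2.trans hL)
  have hUpos : ∀ L, L₁ ≤ L → 0 < U (Real.exp (-L)) := fun L hL =>
    hK.2.2.2.2.2.1 _ (Real.exp_pos _) (by linarith [exp_neg_lt_one (show 0 < L by linarith)])
  have hcd : ∀ L, L₁ ≤ L → Real.exp (-L) * U' (Real.exp (-L)) / U (Real.exp (-L)) ≤ 1 + c / L ∧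
      U (Real.exp (-L)) / (Real.exp (-L) * HL U L) ≤ C / (L * Real.log L) := by
    intro L hL
    have h := hcond (Real.exp (-L)) (Real.exp_pos _) (by
      rw [← Real.lt_log_iff_exp_lt ht₀.1]; linarith)
    rw [Real.log_exp, abs_neg, abs_of_pos (by linarith : 0 < L)] at h
    exact h
  -- monotonicity 1
  have m1 : AntitoneOn (fun L => Real.log (HL U L) - C * Real.log (Real.log L)) (Ici L₁) := by
    have hd : ∀ L, L₁ ≤ L → HasDerivAt (fun L => Real.log (HL U L) - C * Real.log (Real.log L))
        (U (Real.exp (-L)) / Real.exp (-L) / HL U L - C * (L⁻¹ / Real.log L)) L := by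
      intro L hL
      have l1 := hlog1 L hL
      exact ((HL_deriv hK L).log (by linarith [hone L hL])).sub
        (((Real.hasDerivAt_log (by linarith)).log (by linarith)).const_mul C)
    apply antitoneOn_of_deriv_nonpos (convex_Ici _)
    · exact fun L hL => (hd L hL).continuousAt.continuousWithinAt
    · intro L hL
      rw [interior_Ici] at hL
      exact (hd L hL.le).differentiableAt.differentiableWithinAt
    · intro L hL
      rw [interior_Ici] at hL
      have hL' : L₁ ≤ L := hL.le
      rw [(hd L hL').deriv, sub_nonpos]
      refine le_trans (le_of_eq ?_) ((hcd L hL').2.trans (le_of_eq ?_))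
      · rw [div_div]
      · have := hlog1 L hL'
        have : L ≠ 0 := by linarith
        field_simp
  -- monotonicity 2
  have m2 : MonotoneOn (fun L => Real.log (U (Real.exp (-L))) + L + c * Real.log L) (Ici L₁) := by
    have hd : ∀ L, L₁ ≤ L → HasDerivAt (fun L => Real.log (U (Real.exp (-L))) + L + c * Real.log L)
        (U' (Real.exp (-L)) * (Real.exp (-L) * (-1)) / U (Real.exp (-L)) + 1 + c * L⁻¹) L := by
      intro L hL
      have h1 : HasDerivAt (fun L : ℝ => Real.exp (-L)) (Real.exp (-L) * (-1)) L :=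
        ((hasDerivAt_id L).neg).exp
      have h2 : HasDerivAt (fun L => U (Real.exp (-L))) (U' (Real.exp (-L)) * (Real.exp (-L) * (-1))) L :=
        (hderiv (Real.exp (-L)) ⟨Real.exp_pos _, by linarith [exp_neg_lt_one (show 0 < L by linarith)]⟩).comp L h1
      exact ((h2.log (hUpos L hL).ne').add (hasDerivAt_id L)).add
        ((Real.hasDerivAt_log (by linarith)).const_mul c)
    apply monotoneOn_of_deriv_nonneg (convex_Ici _)
    · exact fun L hL => (hd L hL).continuousAt.continuousWithinAt
    · intro L hL
      rw [interior_Ici] at hL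
      exact (hd L hL.le).differentiableAt.differentiableWithinAt
    · intro L hL
      rw [interior_Ici] at hL
      have hL' : L₁ ≤ L := hL.le
      rw [(hd L hL').deriv]
      have := (hcd L hL').1
      have e : U' (Real.exp (-L)) * (Real.exp (-L) * (-1)) / U (Real.exp (-L))
        = - (Real.exp (-L) * U' (Real.exp (-L)) / U (Real.exp (-L))) := by ring
      rw [e]
      rw [div_eq_mul_inv c L] at this
      linarith
  have hgrow : ∀ L L', L₁ ≤ L → L ≤ L' → HL U L' ≤ (Real.log L' / Real.log L) ^ C * HL U L := by
    intro L L' hL hLL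
    have h := m1 (show L ∈ Ici L₁ from hL) (show L' ∈ Ici L₁ from hL.trans hLL) hLL
    simp only at h
    have l1 := hlog1 L hL
    have l2 := hlog1 L' (hL.trans hLL)
    have o1 := hone L hL
    have o2 := hone L' (hL.trans hLL)
    have hr : 0 < Real.log L' / Real.log L := by positivity
    rw [← Real.log_le_log_iff (by linarith) (by positivity), Real.log_mul (by positivity) (by positivity),
      Real.log_rpow hr, Real.log_div (by positivity) (by positivity)]
    linarith
  obtain ⟨K₁, hK₁, hK₁0⟩ : ∃ K₁ : ℝ, (∀ L, L₁ ≤ L → HL U L ≤ K₁ * L) ∧ 0 ≤ K₁ := by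
    refine ⟨C ^ C * HL U L₁, fun L hL => ?_, by have := hone L₁ le_rfl; positivity⟩
    have l0 := hlog1 L₁ le_rfl
    have l1 := hlog1 L hL
    have o1 := hone L₁ le_rfl
    have hL0 : 0 < L := by linarith
    have h1 : Real.log L ≤ L ^ (1 / C) * C := by
      have := Real.log_le_rpow_div hL0.le (show 0 < 1 / C by positivity)
      rwa [div_div_eq_mul_div, div_one] at this
    calc HL U L ≤ (Real.log L / Real.log L₁) ^ C * HL U L₁ := hgrow L₁ L le_rfl hL
      _ ≤ (L ^ (1 / C) * C) ^ C * HL U L₁ := by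
          gcongr
          exact (div_le_self (by linarith) l0).trans h1
      _ = C ^ C * HL U L₁ * L := by
          rw [Real.mul_rpow (by positivity) hC.le, ← Real.rpow_mul hL0.le, one_div,
            inv_mul_cancel₀ hC.ne', Real.rpow_one]; ring
  obtain ⟨K₂, hK₂, hK₂0⟩ : ∃ K₂ : ℝ, (∀ L, L₁ ≤ L → Real.exp (-L) ≤ K₂ * L ^ (⌈c⌉₊) * U (Real.exp (-L))) ∧ 0 ≤ K₂ := by
    set A := Real.log (U (Real.exp (-L₁))) + L₁ + c * Real.log L₁ with hA
    refine ⟨Real.exp (-A), fun L hL => ?_, (Real.exp_pos _).le⟩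
    have h := m2 (Set.mem_Ici.2 le_rfl : L₁ ∈ Ici L₁) (show L ∈ Ici L₁ from hL) hL
    simp only at h
    have hL0 : 0 < L := by linarith
    rw [← hA] at h
    have h2 : L ^ c ≤ L ^ (⌈c⌉₊) := by
      rw [← Real.rpow_natCast]
      exact Real.rpow_le_rpow_of_exponent_le (by linarith) (Nat.le_ceil c)
    calc Real.exp (-L) ≤ Real.exp (-A + c * Real.log L + Real.log (U (Real.exp (-L)))) := by
          apply Real.exp_le_exp.2; linarith
      _ = Real.exp (-A) * L ^ c * U (Real.exp (-L)) := by
          rw [Real.exp_add, Real.exp_add, Real.exp_log (hUpos L hL), Real.rpow_def_of_pos hL0,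
            mul_comm c]
      _ ≤ _ := by
          have := hUpos L hL
          gcongr
  have hUle : ∀ L, L₁ ≤ L → U (Real.exp (-L)) ≤ Real.exp (-L) * HL U L := by
    intro L hL
    have h := (hcd L hL).2
    have h1 := hlog1 L hL
    have o1 := hone L hL
    have : C / (L * Real.log L) ≤ 1 := by
      rw [div_le_one (by have : 0 < L := by linarith
                         positivity)]
      nlinarith
    have h2 := h.trans this
    rwa [div_le_one (by positivity)] at h2
  have hU't : ∀ t, 0 < t → t ≤ Real.exp (-L₁) → U' t ≤ (1 + c) * hU U t := by
    intro t h0 h1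
    obtain ⟨L, rfl⟩ : ∃ L, t = Real.exp (-L) := ⟨-Real.log t, by rw [neg_neg, Real.exp_log h0]⟩
    have hL : L₁ ≤ L := by rw [Real.exp_le_exp] at h1; linarith
    have h := (hcd L hL).1
    have h2 := hUle L hL
    have h3 := hUpos L hL
    have hcL : c / L ≤ c := div_le_self (by linarith) (by linarith)
    rw [div_le_iff₀ h3] at h
    have h4 : Real.exp (-L) * U' (Real.exp (-L)) ≤ Real.exp (-L) * ((1 + c) * HL U L) := by
      calc _ ≤ _ := h
        _ ≤ (1 + c) * U (Real.exp (-L)) := by gcongr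
        _ ≤ (1 + c) * (Real.exp (-L) * HL U L) := by gcongr
        _ = _ := by ring
    exact le_of_mul_le_mul_left h4 (Real.exp_pos _)
  refine ⟨L₁, max (max 1 K₁) (max K₂ (1 + c)), ⌈c⌉₊, hC, b3, ?_, hone, ?_, ?_, hUle, ?_, ?_⟩
  · exact (le_max_left _ _).trans (le_max_left _ _)
  · intro q L L' hq hL hLL hLq
    have o1 := hone L hL
    have l1 := hlog1 L hL
    refine (hgrow L L' hL hLL).trans ?_
    have l2 := hlog1 L' (hL.trans hLL)
    gcongr
    rw [div_le_iff₀ (by linarith)]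
    calc Real.log L' ≤ Real.log (L ^ q) := Real.log_le_log (by linarith) hLq
      _ = _ := Real.log_rpow (by linarith) _
  · intro L hL
    refine (hK₁ L hL).trans ?_
    have : 0 ≤ L := by linarith
    gcongr
    exact (le_max_right _ _).trans (le_max_left _ _)
  · intro L hL
    refine (hK₂ L hL).trans ?_
    have := (hUpos L hL).le
    have : 0 ≤ L := by linarith
    gcongr
    exact (le_max_left _ _).trans (le_max_right _ _)
  · intro a b ha hab hb
    have hbpi : b ≤ Real.pi := by linarith [exp_neg_lt_one (show 0 < L₁ by linarith)]
    have hh : 1 ≤ hU U a := by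
      obtain ⟨L, rfl⟩ : ∃ L, a = Real.exp (-L) := ⟨-Real.log a, by rw [neg_neg, Real.exp_log ha]⟩
      exact hone L (by have := hab.trans hb; rw [Real.exp_le_exp] at this; linarith)
    have := (convex_Icc a b).image_sub_le_mul_sub_of_deriv_le (f := U) hK.1.continuousOn
      (fun x hx => by
        rw [interior_Icc] at hx
        exact (hderiv x ⟨ha.trans hx.1, hx.2.le.trans hbpi⟩).differentiableAt.differentiableWithinAt)
      (C := (1 + c) * hU U a)
      (fun x hx => by
        rw [interior_Icc] at hx
        rw [(hderiv x ⟨ha.trans hx.1, hx.2.le.trans hbpi⟩).deriv]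
        refine (hU't x (ha.trans hx.1) (hx.2.le.trans hb)).trans ?_
        have := h_anti hK a x ha hx.1.le (hx.2.le.trans hbpi)
        gcongr) a ⟨le_rfl, hab⟩ b ⟨hab, le_rfl⟩ hab
    refine this.trans ?_
    have : 0 ≤ b - a := by linarith
    gcongr
    exact (le_max_right _ _).trans (le_max_right _ _)

lemma circle_dist (x θ : ℝ) (hx : x ∈ Icc (-Real.pi) Real.pi) (h0 : 0 ≤ θ) (h1 : θ ≤ Real.pi) :
    |(|x| - θ)| ≤ 2 * ‖circleMap 0 1 x - circleMap 0 1 θ‖ := by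
  have hpi := Real.pi_pos
  have e : ‖circleMap 0 1 x - circleMap 0 1 θ‖ ^ 2 = 2 - 2 * Real.cos (θ - x) := by
    have := norm_circle_sub_sq 1 θ x
    rw [circleMap_one θ]
    rw [ofReal_one, one_mul] at this
    rw [this]; ring
  have hxa : |x| ≤ Real.pi := abs_le.2 hx
  have hcos : Real.cos (θ - x) ≤ Real.cos (|x| - θ) := by
    rcases le_total 0 x with h | h
    · rw [abs_of_nonneg h, ← Real.cos_neg]; apply le_of_eq; congr 1; ring
    · rw [abs_of_nonpos h, Real.cos_sub, Real.cos_sub, Real.cos_neg, Real.sin_neg]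
      have s1 : 0 ≤ Real.sin θ := Real.sin_nonneg_of_nonneg_of_le_pi h0 h1
      have s2 : 0 ≤ Real.sin (-x) := Real.sin_nonneg_of_nonneg_of_le_pi (by linarith) (by linarith [hx.1])
      rw [Real.sin_neg] at s2
      nlinarith
  have hb := Real.cos_le_one_sub_mul_cos_sq (x := |x| - θ)
    (abs_le.2 ⟨by linarith [abs_nonneg x], by linarith⟩)
  have h2 : 2 / Real.pi ^ 2 ≥ 1 / 5 := by
    rw [ge_iff_le, div_le_div_iff₀ (by norm_num) (by positivity)]; nlinarith [Real.pi_lt_d2]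
  apply abs_le_of_sq_le_sq _ (by positivity)
  rw [mul_pow, e]
  nlinarith [sq_nonneg (|x| - θ)]

lemma lip_main {U : ℝ → ℝ} {L₁ K C : ℝ} {p : ℕ} (hK : ClassU U) (hA : Analytic1 U L₁ K C p) :
    ∃ K₃ : ℝ, 0 < K₃ ∧ ∀ L θ, L₁ ≤ L → 2 * Real.exp (-L) ≤ θ → θ ≤ Real.exp (-L₁) / 2 →
      ∀ x ∈ Icc (-Real.pi) Real.pi,
        |U x - U θ| ≤ K₃ * L * ‖circleMap 0 1 x - circleMap 0 1 θ‖ := by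
  have hpi := Real.pi_pos
  have hpi3 := Real.pi_gt_three
  have hK1 := hA.hK1
  have hL3 := hA.hL
  set t₁ := Real.exp (-L₁) with ht₁
  have ht0 : 0 < t₁ := Real.exp_pos _
  have ht1 : t₁ < 1 := exp_neg_lt_one (by linarith)
  have hUpi : 0 ≤ U Real.pi := U_nonneg hK _ ⟨by linarith, le_rfl⟩
  refine ⟨2 * (2 * K ^ 2 + U Real.pi * (2 / t₁)), by positivity, fun L θ hL hθ1 hθ2 x hx => ?_⟩
  set δ := Real.exp (-L) with hδ
  have hδ0 : 0 < δ := Real.exp_pos _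
  have hHl := hA.lin L hL
  have hH1 := hA.one_le L hL
  have hUx : U x = U |x| := by
    rcases abs_choice x with h | h <;> rw [h]
    rw [hK.2.1]
  have hxa : |x| ≤ Real.pi := abs_le.2 hx
  have hd := circle_dist x θ hx (by linarith) (by linarith)
  have hmono := hK.2.2.2.2.1
  have ha0 := abs_nonneg x
  have hθm : θ ∈ Icc 0 Real.pi := ⟨by linarith, by linarith⟩
  have hxm : |x| ∈ Icc 0 Real.pi := ⟨ha0, hxa⟩
  suffices h : |U |x| - U θ| ≤ (2 * K ^ 2 + U Real.pi * (2 / t₁)) * L * |(|x| - θ)| by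
    rw [hUx]
    refine h.trans ?_
    have hc : 0 ≤ (2 * K ^ 2 + U Real.pi * (2 / t₁)) * L := by
      have : 0 ≤ L := by linarith
      positivity
    nlinarith
  have hUx0 : 0 ≤ U |x| := by rw [← hUx]; exact U_nonneg hK x hx
  have hUθ0 : 0 ≤ U θ := U_nonneg hK θ ⟨by linarith, hθm.2⟩
  have hcoef1 : 2 * (K * HL U L) ≤ (2 * K ^ 2 + U Real.pi * (2 / t₁)) * L := by
    have : 0 ≤ U Real.pi * (2 / t₁) * L := by
      have : 0 ≤ L := by linarith
      positivity
    nlinarith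
  have hhθ : hU U θ ≤ HL U L := h_anti hK _ _ hδ0 (by linarith) hθm.2
  rcases lt_or_ge |x| δ with h1 | h1
  · have hle : U |x| ≤ U θ := hmono hxm hθm (by linarith)
    rw [abs_of_nonpos (by linarith), abs_of_nonpos (by linarith : |x| - θ ≤ 0)]
    have e : U θ ≤ θ * hU U θ := by
      have h0θ : 0 < θ := by linarith
      obtain ⟨M, hM⟩ : ∃ M, θ = Real.exp (-M) := ⟨-Real.log θ, by rw [neg_neg, Real.exp_log h0θ]⟩
      rw [hM]
      apply hA.Ule M
      have : Real.exp (-M) ≤ Real.exp (-L₁) := by rw [← hM]; linarith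
      rw [Real.exp_le_exp] at this; linarith
    have e2 : U θ ≤ 2 * HL U L * (θ - |x|) := by nlinarith
    have e3 : 2 * HL U L ≤ 2 * (K * HL U L) := by nlinarith
    nlinarith
  rcases le_or_gt |x| t₁ with h2 | h2
  · have key : |U |x| - U θ| ≤ K * HL U L * |(|x| - θ)| := by
      rcases le_total |x| θ with h3 | h3
      · have hle : U |x| ≤ U θ := hmono hxm hθm h3
        rw [abs_of_nonpos (by linarith), abs_of_nonpos (by linarith : |x| - θ ≤ 0)]
        have := hA.lip |x| θ (by linarith) h3 (by linarith)
        have hh : hU U |x| ≤ HL U L := h_anti hK _ _ hδ0 h1 hxa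
        have : K * hU U |x| * (θ - |x|) ≤ K * HL U L * (θ - |x|) := by
          apply mul_le_mul_of_nonneg_right _ (by linarith)
          apply mul_le_mul_of_nonneg_left hh (by linarith)
        linarith
      · have hle : U θ ≤ U |x| := hmono hθm hxm h3
        rw [abs_of_nonneg (by linarith), abs_of_nonneg (by linarith : 0 ≤ |x| - θ)]
        have := hA.lip θ |x| (by linarith) h3 h2
        have : K * hU U θ * (|x| - θ) ≤ K * HL U L * (|x| - θ) := by
          apply mul_le_mul_of_nonneg_right _ (by linarith)
          apply mul_le_mul_of_nonneg_left hhθ (by linarith)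
        linarith
    refine key.trans (mul_le_mul_of_nonneg_right ?_ (abs_nonneg _))
    nlinarith
  · have hle : U θ ≤ U |x| := hmono hθm hxm (by linarith)
    rw [abs_of_nonneg (by linarith), abs_of_nonneg (by linarith : 0 ≤ |x| - θ)]
    have h5 : U |x| ≤ U Real.pi := hmono hxm ⟨hpi.le, le_rfl⟩ hxa
    have h6 : t₁ / 2 ≤ |x| - θ := by linarith
    have h7 : 1 ≤ (2 / t₁) * (|x| - θ) := by
      rw [div_mul_eq_mul_div, le_div_iff₀ ht0]; linarith
    have h8 : U Real.pi ≤ U Real.pi * ((2 / t₁) * (|x| - θ)) := le_mul_of_one_le_right hUpi h7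
    have h9 : 0 ≤ 2 * K ^ 2 * L * (|x| - θ) := by
      have : 0 ≤ L := by linarith
      have : 0 ≤ |x| - θ := by linarith
      positivity
    have h10 : U Real.pi * (2 / t₁) * (|x| - θ) ≤ U Real.pi * (2 / t₁) * (|x| - θ) * L := by
      apply le_mul_of_one_le_right
      · have : 0 ≤ |x| - θ := by linarith
        positivity
      · linarith
    nlinarith

lemma gram_bound {E : Type*} [NormedAddCommGroup E] [InnerProductSpace ℂ E] (n : ℕ) (hn : 0 < n)
    (w : Fin n → E)
    (h : ∀ i j, i ≠ j → ‖inner ℂ (w i) (w j)‖ ≤ ‖w i‖ * ‖w j‖ / (2 * n)) :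
    |‖∑ i, w i‖ ^ 2 - ∑ i, ‖w i‖ ^ 2| ≤ (∑ i, ‖w i‖ ^ 2) / 2 := by
  have hn' : (0:ℝ) < n := by exact_mod_cast hn
  have e1 : ((‖∑ i, w i‖ ^ 2 : ℝ) : ℂ) = ∑ i, ∑ j, inner ℂ (w i) (w j) := by
    have h1 := inner_self_eq_norm_sq_to_K (𝕜 := ℂ) (∑ i, w i)
    rw [sum_inner] at h1
    simp only [inner_sum] at h1
    rw [h1]; push_cast; rfl
  have e2 : (((‖∑ i, w i‖ ^ 2 - ∑ i, ‖w i‖ ^ 2 : ℝ)) : ℂ)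
      = ∑ i, ∑ j, (if i = j then 0 else inner ℂ (w i) (w j)) := by
    rw [Complex.ofReal_sub, e1, Complex.ofReal_sum, ← Finset.sum_sub_distrib]
    refine Finset.sum_congr rfl fun i _ => ?_
    have : ∑ j, (if i = j then 0 else inner ℂ (w i) (w j))
        = ∑ j, (inner ℂ (w i) (w j) - if i = j then inner ℂ (w i) (w j) else 0) := by
      refine Finset.sum_congr rfl fun j _ => ?_
      split_ifs <;> simp
    rw [this, Finset.sum_sub_distrib, Finset.sum_ite_eq]
    simp only [Finset.mem_univ, if_true]
    congr 1
    rw [inner_self_eq_norm_sq_to_K]; push_cast; rfl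
  have e3 : |‖∑ i, w i‖ ^ 2 - ∑ i, ‖w i‖ ^ 2| ≤ ∑ i, ∑ j, ‖w i‖ * ‖w j‖ / (2 * n) := by
    rw [← Real.norm_eq_abs, ← Complex.norm_real, e2]
    refine (norm_sum_le _ _).trans (Finset.sum_le_sum fun i _ => ?_)
    refine (norm_sum_le _ _).trans (Finset.sum_le_sum fun j _ => ?_)
    split_ifs with hij
    · simp; positivity
    · exact h i j hij
  refine e3.trans ?_
  have e4 : ∑ i, ∑ j, ‖w i‖ * ‖w j‖ / (2 * n) = (∑ i, ‖w i‖) ^ 2 / (2 * n) := by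
    rw [sq, Finset.sum_mul_sum, Finset.sum_div]
    refine Finset.sum_congr rfl fun i _ => ?_
    rw [Finset.sum_div]
  rw [e4]
  have e5 := sq_sum_le_card_mul_sum_sq (s := (Finset.univ : Finset (Fin n))) (f := fun i => ‖w i‖)
  simp only [Finset.card_univ, Fintype.card_fin] at e5
  rw [div_le_div_iff₀ (by positivity) (by norm_num)]
  nlinarith

lemma lower_abstract (T : H2 →L[ℂ] H2) (n : ℕ) (hn : 0 < n) (v v' : Fin n → H2)
    (hv' : ∀ i, ContinuousLinearMap.adjoint T (v i) = v' i) (s : ℝ) (hs : 0 ≤ s)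
    (hv0 : ∀ i, v i ≠ 0)
    (hsv : ∀ i, s * ‖v i‖ ^ 2 ≤ ‖v' i‖ ^ 2)
    (h : ∀ i j, i ≠ j → ‖inner ℂ (v i) (v j)‖ ≤ ‖v i‖ * ‖v j‖ / (2 * n))
    (h' : ∀ i j, i ≠ j → ‖inner ℂ (v' i) (v' j)‖ ≤ ‖v' i‖ * ‖v' j‖ / (2 * n))
    (R : H2 →L[ℂ] H2) (hR : FiniteDimensional ℂ (LinearMap.range R.toLinearMap))
    (hRn : Module.finrank ℂ (LinearMap.range R.toLinearMap) ≤ n - 1) :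
    s / 3 ≤ ‖T - R‖ ^ 2 := by
  set S := LinearMap.range R.toLinearMap with hS
  let P : (Fin n → ℂ) →ₗ[ℂ] S := (S.orthogonalProjectionOnto.toLinearMap) ∘ₗ (Fintype.linearCombination ℂ v)
  have hker : LinearMap.ker P ≠ ⊥ := by
    apply LinearMap.ker_ne_bot_of_finrank_lt
    rw [Module.finrank_fin_fun]; omega
  obtain ⟨c, hc, hc0⟩ := Submodule.exists_mem_ne_zero_of_ne_bot hker
  set x := ∑ i, c i • v i with hx
  have hxo : x ∈ Sᗮ := by
    rw [← Submodule.orthogonalProjectionOnto_eq_zero_iff]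
    have : P c = 0 := hc
    rw [hx, ← this]
    simp only [P, LinearMap.comp_apply, Fintype.linearCombination_apply]
    rfl
  have scal : ∀ u : Fin n → H2, (∀ i j, i ≠ j → ‖inner ℂ (u i) (u j)‖ ≤ ‖u i‖ * ‖u j‖ / (2 * n)) →
      |‖∑ i, c i • u i‖ ^ 2 - ∑ i, ‖c i • u i‖ ^ 2| ≤ (∑ i, ‖c i • u i‖ ^ 2) / 2 := by
    intro u hu
    apply gram_bound n hn
    intro i j hij
    rw [inner_smul_left, inner_smul_right, norm_mul, norm_mul, norm_smul, norm_smul, RCLike.norm_conj]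
    calc ‖c i‖ * (‖c j‖ * ‖inner ℂ (u i) (u j)‖) ≤ ‖c i‖ * (‖c j‖ * (‖u i‖ * ‖u j‖ / (2 * n))) := by
          gcongr; exact hu i j hij
      _ = _ := by ring
  have g1 := abs_le.1 (scal v h)
  have g2 := abs_le.1 (scal v' h')
  rw [← hx] at g1
  have hTx : ContinuousLinearMap.adjoint T x = ∑ i, c i • v' i := by
    rw [hx, map_sum]; simp only [map_smul, hv']
  rw [← hTx] at g2
  set y := ContinuousLinearMap.adjoint T x with hy
  have hsum : s * ∑ i, ‖c i • v i‖ ^ 2 ≤ ∑ i, ‖c i • v' i‖ ^ 2 := by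
    rw [Finset.mul_sum]
    refine Finset.sum_le_sum fun i _ => ?_
    rw [norm_smul, norm_smul, mul_pow, mul_pow]
    nlinarith [hsv i, sq_nonneg ‖c i‖]
  have hpos : 0 < ∑ i, ‖c i • v i‖ ^ 2 := by
    obtain ⟨i, hi⟩ := Function.ne_iff.1 hc0
    refine Finset.sum_pos' (fun _ _ => by positivity) ⟨i, Finset.mem_univ _, ?_⟩
    have : c i • v i ≠ 0 := smul_ne_zero hi (hv0 i)
    positivity
  have hyx : ‖y‖ ≤ ‖T - R‖ * ‖x‖ := by
    have hRy : inner ℂ (R y) x = 0 :=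
      Submodule.inner_right_of_mem_orthogonal (K := S) ⟨y, rfl⟩ hxo
    have e : inner ℂ ((T - R) y) x = inner ℂ y y := by
      rw [sub_apply, inner_sub_left, ← ContinuousLinearMap.adjoint_inner_right,
        ← hy, hRy, sub_zero]
    have e2 : ‖y‖ ^ 2 ≤ ‖(T - R) y‖ * ‖x‖ := by
      have := norm_inner_le_norm (𝕜 := ℂ) ((T - R) y) x
      rw [e, inner_self_eq_norm_sq_to_K] at this
      simpa using this
    have e3 := (T - R).le_opNorm y
    rcases (norm_nonneg y).eq_or_lt with h0 | h0
    · rw [← h0]; positivity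
    · have : ‖y‖ * ‖y‖ ≤ (‖T - R‖ * ‖x‖) * ‖y‖ := by nlinarith [norm_nonneg x]
      exact le_of_mul_le_mul_right this h0
  have hyx2 : ‖y‖ ^ 2 ≤ ‖T - R‖ ^ 2 * ‖x‖ ^ 2 := by
    rw [← mul_pow]; exact pow_le_pow_left₀ (norm_nonneg _) hyx 2
  have hx0 : 0 < ‖x‖ ^ 2 := by linarith [g1.1]
  by_contra hcon
  push Not at hcon
  nlinarith [g1.2, g2.1]

lemma kz_almost_orth (z w : ℂ) (hz : ‖z‖ < 1) (hw : ‖w‖ < 1) (ε : ℝ) (hε : 0 < ε)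
    (h : 4 * (1 - ‖z‖) ≤ ε ^ 2 * (1 - ‖w‖) ∨ 4 * (1 - ‖w‖) ≤ ε ^ 2 * (1 - ‖z‖)) :
    ‖inner ℂ (kz z hz) (kz w hw)‖ ≤ ‖kz z hz‖ * ‖kz w hw‖ * ε := by
  rw [inner_kz_kz, norm_inv]
  have h1 : 1 - ‖w‖ * ‖z‖ ≤ ‖1 - (starRingEnd ℂ) w * z‖ := by
    have := norm_sub_norm_le (1:ℂ) ((starRingEnd ℂ) w * z)
    rw [norm_mul, RCLike.norm_conj, norm_one] at this
    exact this
  have z0 := norm_nonneg z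
  have w0 := norm_nonneg w
  have hp : 0 < 1 - ‖w‖ * ‖z‖ := by nlinarith
  apply abs_le_of_sq_le_sq' _ (by positivity) |>.2
  rw [mul_pow, mul_pow, norm_kz_sq, norm_kz_sq, inv_pow]
  have hz2 : 0 < 1 - ‖z‖ ^ 2 := by nlinarith
  have hw2 : 0 < 1 - ‖w‖ ^ 2 := by nlinarith
  have e : 1 / (1 - ‖z‖ ^ 2) * (1 / (1 - ‖w‖ ^ 2)) * ε ^ 2 = ε ^ 2 / ((1 - ‖z‖ ^ 2) * (1 - ‖w‖ ^ 2)) := by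
    field_simp
  rw [e]
  calc (‖1 - (starRingEnd ℂ) w * z‖ ^ 2)⁻¹ ≤ ((1 - ‖w‖ * ‖z‖) ^ 2)⁻¹ := by gcongr
    _ ≤ _ := by
      rw [inv_eq_one_div, div_le_div_iff₀ (by positivity) (by positivity), one_mul]
      have i1 : (1 - ‖z‖ ^ 2) * (1 - ‖w‖ ^ 2) ≤ 4 * ((1 - ‖z‖) * (1 - ‖w‖)) := by
        have a1 : 1 - ‖z‖ ^ 2 ≤ 2 * (1 - ‖z‖) := by nlinarith
        have a2 : 1 - ‖w‖ ^ 2 ≤ 2 * (1 - ‖w‖) := by nlinarith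
        calc _ ≤ (2 * (1 - ‖z‖)) * (2 * (1 - ‖w‖)) := by gcongr
          _ = _ := by ring
      have i2 : 1 - ‖z‖ ≤ 1 - ‖w‖ * ‖z‖ := by nlinarith
      have i3 : 1 - ‖w‖ ≤ 1 - ‖w‖ * ‖z‖ := by nlinarith
      rcases h with h | h
      · calc _ ≤ _ := i1
          _ = 4 * (1 - ‖z‖) * (1 - ‖w‖) := by ring
          _ ≤ ε ^ 2 * (1 - ‖w‖) * (1 - ‖w‖) := by gcongr
          _ = ε ^ 2 * (1 - ‖w‖) ^ 2 := by ring
          _ ≤ _ := by gcongr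
      · calc _ ≤ _ := i1
          _ = 4 * (1 - ‖w‖) * (1 - ‖z‖) := by ring
          _ ≤ ε ^ 2 * (1 - ‖z‖) * (1 - ‖z‖) := by gcongr
          _ = ε ^ 2 * (1 - ‖z‖) ^ 2 := by ring
          _ ≤ _ := by gcongr

lemma phi_norm {U : ℝ → ℝ} {F φ : ℂ → ℂ}
    (hFre : ∀ r θ : ℝ, 0 ≤ r → r < 1 →
      (F ((r : ℂ) * Complex.exp (θ * Complex.I))).re = poisson U r θ)
    (hφ : ∀ z, φ z = Complex.exp (-F z)) (r θ : ℝ) (h0 : 0 ≤ r) (h1 : r < 1) :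
    ‖φ ((r : ℂ) * Complex.exp (θ * Complex.I))‖ = Real.exp (-poisson U r θ) := by
  rw [hφ, Complex.norm_exp, Complex.neg_re, hFre r θ h0 h1]

lemma phi_lt {U : ℝ → ℝ} (hK : ClassU U) {F φ : ℂ → ℂ}
    (hFre : ∀ r θ : ℝ, 0 ≤ r → r < 1 →
      (F ((r : ℂ) * Complex.exp (θ * Complex.I))).re = poisson U r θ)
    (hφ : ∀ z, φ z = Complex.exp (-F z)) (z : ℂ) (hz : ‖z‖ < 1) : ‖φ z‖ < 1 := by
  have e : z = (‖z‖ : ℂ) * Complex.exp (z.arg * I) := (Complex.norm_mul_exp_arg_mul_I z).symm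
  rw [e, phi_norm hFre hφ _ _ (norm_nonneg z) hz, Real.exp_lt_one_iff]
  linarith [poisson_pos hK ‖z‖ z.arg (norm_nonneg z) hz]

lemma phi_diff {F φ : ℂ → ℂ} (hF : DifferentiableOn ℂ F (Metric.ball 0 1))
    (hφ : ∀ z, φ z = Complex.exp (-F z)) : DifferentiableOn ℂ φ (Metric.ball 0 1) := by
  have : φ = fun z => Complex.exp (-F z) := funext hφ
  rw [this]
  exact hF.neg.cexp

/-- two-sided estimate of `1 - |φ(1-δ)|`. -/
lemma phi_radial {U : ℝ → ℝ} (hK : ClassU U) {F φ : ℂ → ℂ} {L₁ K C : ℝ} {p : ℕ}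
    (hA : Analytic1 U L₁ K C p)
    (hFre : ∀ r θ : ℝ, 0 ≤ r → r < 1 →
      (F ((r : ℂ) * Complex.exp (θ * Complex.I))).re = poisson U r θ)
    (hφ : ∀ z, φ z = Complex.exp (-F z)) :
    ∃ L₄, L₁ ≤ L₄ ∧ ∀ L, L₄ ≤ L →
      Real.exp (-L) * HL U L / 32 ≤ 1 - ‖φ ((1 - Real.exp (-L) : ℝ) : ℂ)‖ ∧
      1 - ‖φ ((1 - Real.exp (-L) : ℝ) : ℂ)‖ ≤ 8 * (Real.exp (-L) * HL U L) := by
  have hL3 := hA.hL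
  have ht : Tendsto (fun L : ℝ => L * Real.exp (-L)) atTop (nhds 0) := by
    simpa using Real.tendsto_pow_mul_exp_neg_atTop_nhds_zero 1
  have hK0 : 0 < K := by linarith [hA.hK1]
  obtain ⟨L₄, hL₄⟩ := (ht.eventually (gt_mem_nhds (show (0:ℝ) < 1 / (8 * K) by positivity))).exists_forall_of_atTop
  refine ⟨max L₁ L₄, le_max_left _ _, fun L hL => ?_⟩
  have hL1 : L₁ ≤ L := (le_max_left _ _).trans hL
  have hsm := hL₄ L ((le_max_right _ _).trans hL)
  set δ := Real.exp (-L) with hδ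
  have hδ0 : 0 < δ := Real.exp_pos _
  have hδ2 : δ ≤ 1 / 2 := by
    have h1 : δ ≤ Real.exp (-1) := Real.exp_le_exp.2 (by linarith)
    have h2 := Real.exp_neg_one_lt_d9
    linarith
  have hH := hA.one_le L hL1
  have hUl := hA.Ule L hL1
  have hlin := hA.lin L hL1
  have hn : ‖φ ((1 - δ : ℝ) : ℂ)‖ = Real.exp (-poisson U (1 - δ) 0) := by
    have := phi_norm hFre hφ (1 - δ) 0 (by linarith) (by linarith)
    simpa using this
  rw [hn]
  have lo := poisson_lower2 hK δ hδ0 (by linarith)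
  have up := poisson_upper hK δ hδ0 hδ2
  set u := poisson U (1 - δ) 0 with hu
  change δ * HL U L / (4 * Real.pi) ≤ u at lo
  change u ≤ 4 * (U δ + δ * HL U L) at up
  have lo' : δ * HL U L / 16 ≤ u := by
    refine le_trans ?_ lo
    apply div_le_div_of_nonneg_left (by positivity) (by positivity)
    linarith [Real.pi_lt_d2]
  have up' : u ≤ 8 * (δ * HL U L) := by linarith
  have u1 : u ≤ 1 := by
    have : δ * HL U L ≤ K * (L * δ) := by nlinarith
    have h2 : K * (L * δ) ≤ K * (1 / (8 * K)) := by gcongr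
    have h3 : K * (1 / (8 * K)) = 1 / 8 := by field_simp
    linarith
  have u0 : 0 ≤ u := le_trans (by positivity) lo'
  constructor
  · have h1 : Real.exp (-u) ≤ 1 - u / 2 := by
      have h3 : 1 + u ≤ Real.exp u := by linarith [Real.add_one_le_exp u]
      have h4 : Real.exp (-u) ≤ 1 / (1 + u) := by
        rw [Real.exp_neg, inv_eq_one_div]
        exact one_div_le_one_div_of_le (by linarith) h3
      refine h4.trans ?_
      rw [div_le_iff₀ (by linarith)]
      nlinarith
    linarith
  · linarith [Real.add_one_le_exp (-u)]

lemma adjoint_kz {φ : ℂ → ℂ} (T : H2 →L[ℂ] H2) (hm : ∀ z, ‖z‖ < 1 → ‖φ z‖ < 1)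
    (hT : ∀ (a : H2) (z : ℂ), ‖z‖ < 1 → fa (T a) z = fa a (φ z)) (z : ℂ) (hz : ‖z‖ < 1) :
    ContinuousLinearMap.adjoint T (kz z hz) = kz (φ z) (hm z hz) := by
  apply ext_inner_right ℂ
  intro a
  rw [ContinuousLinearMap.adjoint_inner_left, inner_kz, inner_kz, hT a z hz]

lemma lower_bound {U : ℝ → ℝ} (hK : ClassU U) {F φ : ℂ → ℂ} {L₁ K C : ℝ} {p : ℕ}
    (hA : Analytic1 U L₁ K C p)
    (hFre : ∀ r θ : ℝ, 0 ≤ r → r < 1 →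
      (F ((r : ℂ) * Complex.exp (θ * Complex.I))).re = poisson U r θ)
    (hφ : ∀ z, φ z = Complex.exp (-F z)) (T : H2 →L[ℂ] H2)
    (hT : ∀ (a : H2) (z : ℂ), ‖z‖ < 1 → fa (T a) z = fa a (φ z)) :
    ∃ c₁ : ℝ, 0 < c₁ ∧ ∃ N : ℕ, ∀ n : ℕ, N ≤ n →
      c₁ * (HL U (Real.sqrt n)) ^ (-(1 : ℝ) / 2) ≤ approxNum T n := by
  obtain ⟨L₄, hL41, hrad⟩ := phi_radial hK hA hFre hφ
  have hL3 := hA.hL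
  have hm := phi_lt hK hFre hφ
  have ht : Tendsto (fun x : ℝ => x ^ 2 * Real.exp (-x)) atTop (nhds 0) := by
    simpa using Real.tendsto_pow_mul_exp_neg_atTop_nhds_zero 2
  set A : ℝ := 256 * 2 ^ C with hAdef
  have hA1 : 1 ≤ A := by
    have : (1:ℝ) ≤ 2 ^ C := Real.one_le_rpow (by norm_num) hA.hC.le
    linarith
  obtain ⟨x₀, hx₀⟩ := (ht.eventually (gt_mem_nhds (show (0:ℝ) < 1 / (16 * A) by positivity))).exists_forall_of_atTop
  have hC4 : (0:ℝ) < 4 ^ C := by positivity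
  refine ⟨(48 * 4 ^ C) ^ (-(1:ℝ) / 2), by positivity, ⌈max (max x₀ L₄) (L₁ ^ 2)⌉₊ + 1, fun n hn => ?_⟩
  have hnr : max (max x₀ L₄) (L₁ ^ 2) ≤ n := by
    refine (Nat.le_ceil _).trans ?_
    exact_mod_cast (Nat.le_succ _).trans hn
  have hn0 : 0 < n := by omega
  have hnx : x₀ ≤ n := ((le_max_left _ _).trans (le_max_left _ _)).trans hnr
  have hnL : L₄ ≤ n := ((le_max_right _ _).trans (le_max_left _ _)).trans hnr
  have hnL1 : L₁ ^ 2 ≤ n := (le_max_right _ _).trans hnr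
  have hn1 : (1:ℝ) ≤ n := by linarith
  have hexp : Real.exp (-n) * A ≤ 1 / (16 * (n:ℝ) ^ 2) := by
    have := hx₀ n hnx
    rw [lt_div_iff₀ (by positivity)] at this
    rw [le_div_iff₀ (by positivity)]
    linarith
  have hsq1 : L₁ ≤ Real.sqrt n := Real.le_sqrt_of_sq_le hnL1
  have hHs := hA.one_le _ hsq1
  -- points
  let Lj : Fin n → ℝ := fun j => n * (j + 1)
  have hLj : ∀ j, (n:ℝ) ≤ Lj j ∧ Lj j ≤ n ^ 2 := by
    intro j
    have h2 : ((j:ℕ):ℝ) + 1 ≤ n := by exact_mod_cast j.2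
    have h3 : (0:ℝ) ≤ (j:ℕ) := by positivity
    constructor
    · simp only [Lj]; nlinarith
    · simp only [Lj]; nlinarith
  let zj : Fin n → ℂ := fun j => ((1 - Real.exp (-Lj j) : ℝ) : ℂ)
  have hLpos : ∀ j, 0 < Lj j := fun j => by linarith [(hLj j).1]
  have nzj : ∀ j, ‖zj j‖ = 1 - Real.exp (-Lj j) := fun j => by
    simp only [zj]
    rw [Complex.norm_real, Real.norm_of_nonneg]
    linarith [exp_neg_lt_one (hLpos j)]
  have hz1 : ∀ j, ‖zj j‖ < 1 := fun j => by rw [nzj]; linarith [Real.exp_pos (-Lj j)]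
  have hr : ∀ j, Real.exp (-Lj j) * HL U (Lj j) / 32 ≤ 1 - ‖φ (zj j)‖ ∧
      1 - ‖φ (zj j)‖ ≤ 8 * (Real.exp (-Lj j) * HL U (Lj j)) := fun j =>
    hrad (Lj j) (by linarith [(hLj j).1])
  have hH1 : ∀ j, 1 ≤ HL U (Lj j) := fun j => hA.one_le _ (by linarith [(hLj j).1])
  have hsep : ∀ i j : Fin n, i < j → Real.exp (-Lj j) ≤ Real.exp (-n) * Real.exp (-Lj i) := by
    intro i j hij
    rw [← Real.exp_add]
    apply Real.exp_le_exp.2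
    simp only [Lj]
    have : ((i:ℕ):ℝ) + 1 ≤ (j:ℕ) := by exact_mod_cast hij
    nlinarith
  have hHij : ∀ i j : Fin n, HL U (Lj j) ≤ 2 ^ C * HL U (Lj i) := by
    intro i j
    rcases le_total (Lj i) (Lj j) with h | h
    · apply hA.power 2 _ _ (by norm_num) (by linarith [(hLj i).1]) h
      rw [Real.rpow_two]
      refine (hLj j).2.trans (pow_le_pow_left₀ (by linarith) (hLj i).1 2)
    · have h1 := HL_mono hK _ _ (hLpos j).le h
      have h2 : (1:ℝ) ≤ 2 ^ C := Real.one_le_rpow (by norm_num) hA.hC.le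
      nlinarith [hH1 i]
  have sepz : ∀ i j : Fin n, i < j → 4 * (1 - ‖zj j‖) ≤ (1 / (2 * (n:ℝ))) ^ 2 * (1 - ‖zj i‖) := by
    intro i j hij
    rw [nzj, nzj, sub_sub_cancel, sub_sub_cancel]
    have h1 := hsep i j hij
    have h2 : Real.exp (-n) ≤ 1 / (16 * (n:ℝ) ^ 2) := by
      refine le_trans ?_ hexp
      exact le_mul_of_one_le_right (Real.exp_pos _).le hA1
    have h3 : Real.exp (-n) * Real.exp (-Lj i) ≤ 1 / (16 * (n:ℝ) ^ 2) * Real.exp (-Lj i) := by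
      gcongr
    have e : (1 / (2 * (n:ℝ))) ^ 2 = 4 * (1 / (16 * (n:ℝ) ^ 2)) := by field_simp; norm_num
    rw [e]; linarith
  have sepw : ∀ i j : Fin n, i < j → 4 * (1 - ‖φ (zj j)‖) ≤ (1 / (2 * (n:ℝ))) ^ 2 * (1 - ‖φ (zj i)‖) := by
    intro i j hij
    have h1 := hsep i j hij
    have h2 := (hr j).2
    have h3 := (hr i).1
    have e : (1 / (2 * (n:ℝ))) ^ 2 = 4 * (1 / (16 * (n:ℝ) ^ 2)) := by field_simp; norm_num
    rw [e]
    have h4 : 1 - ‖φ (zj j)‖ ≤ 1 / (16 * (n:ℝ) ^ 2) * (1 - ‖φ (zj i)‖) := by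
      calc 1 - ‖φ (zj j)‖ ≤ 8 * (Real.exp (-Lj j) * HL U (Lj j)) := h2
        _ ≤ 8 * ((Real.exp (-n) * Real.exp (-Lj i)) * (2 ^ C * HL U (Lj i))) := by
            have := hH1 j
            gcongr
            exact hHij i j
        _ = (Real.exp (-n) * A) * (Real.exp (-Lj i) * HL U (Lj i) / 32) := by rw [hAdef]; ring
        _ ≤ 1 / (16 * (n:ℝ) ^ 2) * (1 - ‖φ (zj i)‖) := by
            have := hH1 i
            gcongr
    linarith
  have main : ∀ R : H2 →L[ℂ] H2, FiniteDimensional ℂ (LinearMap.range R.toLinearMap) →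
      Module.finrank ℂ (LinearMap.range R.toLinearMap) ≤ n - 1 →
      1 / (16 * HL U ((n:ℝ) ^ 2)) / 3 ≤ ‖T - R‖ ^ 2 := by
    intro R hR hRn
    have hHn : 1 ≤ HL U ((n:ℝ) ^ 2) := hA.one_le _ (by nlinarith)
    apply lower_abstract T n hn0 (fun j => kz (zj j) (hz1 j)) (fun j => kz (φ (zj j)) (hm _ (hz1 j)))
      (fun j => adjoint_kz T hm hT _ _) (1 / (16 * HL U ((n:ℝ) ^ 2))) (by positivity) _ _ _ _ R hR hRn
    · intro i h0
      have := norm_kz_sq (zj i) (hz1 i)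
      rw [h0] at this
      have h2 : 0 < 1 / (1 - ‖zj i‖ ^ 2) := by
        have := hz1 i
        have := norm_nonneg (zj i)
        apply div_pos one_pos; nlinarith
      simp at this
      simp [← this] at h2
    · intro i
      rw [norm_kz_sq, norm_kz_sq]
      have a1 := hz1 i
      have a2 := hm _ (hz1 i)
      have a3 := norm_nonneg (zj i)
      have a4 := norm_nonneg (φ (zj i))
      have q1 : 0 < 1 - ‖zj i‖ ^ 2 := by nlinarith
      have q2 : 0 < 1 - ‖φ (zj i)‖ ^ 2 := by nlinarith
      rw [div_mul_div_comm, one_mul, div_le_div_iff₀ (by positivity) (by positivity), one_mul, one_mul]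
      have b1 : 1 - ‖φ (zj i)‖ ^ 2 ≤ 2 * (1 - ‖φ (zj i)‖) := by nlinarith
      have b2 : Real.exp (-Lj i) ≤ 1 - ‖zj i‖ ^ 2 := by
        have := nzj i
        nlinarith
      have b3 := (hr i).2
      have b4 := HL_mono hK _ _ (hLpos i).le (hLj i).2
      calc 1 - ‖φ (zj i)‖ ^ 2 ≤ 16 * (Real.exp (-Lj i) * HL U (Lj i)) := by linarith
        _ ≤ 16 * ((1 - ‖zj i‖ ^ 2) * HL U ((n:ℝ) ^ 2)) := by
            have := hH1 i
            gcongr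
        _ = _ := by ring
    · intro i j hij
      have := kz_almost_orth (zj i) (zj j) (hz1 i) (hz1 j) (1 / (2 * n)) (by positivity) (by
        rcases lt_or_gt_of_ne hij with h | h
        · right; exact sepz i j h
        · left; exact sepz j i h)
      rwa [mul_one_div] at this
    · intro i j hij
      have := kz_almost_orth (φ (zj i)) (φ (zj j)) (hm _ (hz1 i)) (hm _ (hz1 j)) (1 / (2 * n)) (by positivity) (by
        rcases lt_or_gt_of_ne hij with h | h
        · right; exact sepw i j h
        · left; exact sepw j i h)
      rwa [mul_one_div] at this
  have hpow : HL U ((n:ℝ) ^ 2) ≤ 4 ^ C * HL U (Real.sqrt n) := by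
    apply hA.power 4 _ _ (by norm_num) hsq1
    · have : Real.sqrt n ≤ n := by
        rw [Real.sqrt_le_iff]; constructor
        · positivity
        · nlinarith
      nlinarith
    · have : Real.sqrt n ^ (4:ℝ) = (n:ℝ) ^ 2 := by
        rw [show (4:ℝ) = ((4:ℕ):ℝ) by norm_num, Real.rpow_natCast,
          show Real.sqrt n ^ 4 = (Real.sqrt n ^ 2) ^ 2 by ring, Real.sq_sqrt (by positivity)]
      rw [this]
  unfold approxNum
  apply le_csInf
  · refine ⟨_, 0, ?_, ?_, rfl⟩
    · have : LinearMap.range (0 : H2 →L[ℂ] H2).toLinearMap = ⊥ := by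
        ext x; simp
      rw [this]; infer_instance
    · have : LinearMap.range (0 : H2 →L[ℂ] H2).toLinearMap = ⊥ := by
        ext x; simp
      rw [this]; simp
  · rintro _ ⟨R, hR, hRn, rfl⟩
    have h := main R hR hRn
    have hHn : 1 ≤ HL U ((n:ℝ) ^ 2) := hA.one_le _ (by nlinarith)
    rw [← Real.mul_rpow (by positivity) (by positivity)]
    have e : ((48 * 4 ^ C) * HL U (Real.sqrt n)) ^ (-(1:ℝ) / 2)
        = Real.sqrt (1 / ((48 * 4 ^ C) * HL U (Real.sqrt n))) := by
      have hq : 0 ≤ (48 * 4 ^ C) * HL U (Real.sqrt n) := by positivity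
      generalize (48 * 4 ^ C) * HL U (Real.sqrt n) = Q at hq
      rw [Real.sqrt_eq_rpow, one_div Q, ← Real.rpow_neg_one, ← Real.rpow_mul hq]
      norm_num
    rw [e]
    apply Real.sqrt_le_iff.2 ⟨norm_nonneg _, ?_⟩
    refine le_trans ?_ h
    rw [div_div]
    apply one_div_le_one_div_of_le (by positivity)
    nlinarith

lemma approx_le (T : H2 →L[ℂ] H2) (n : ℕ) {ι : Type} [Fintype ι] (y : ι → H2)
    (hn : Fintype.card ι ≤ n - 1) (B : ℝ) (hB : 0 ≤ B)
    (h : ∀ b, (∀ i, inner ℂ (y i) b = 0) → ‖T b‖ ≤ B * ‖b‖) : approxNum T n ≤ B := by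
  classical
  set S : Submodule ℂ H2 := Submodule.span ℂ (Set.range y) with hS
  have : FiniteDimensional ℂ S := FiniteDimensional.span_of_finite ℂ (Set.finite_range y)
  have hfS : Module.finrank ℂ S ≤ Fintype.card ι := finrank_range_le_card y
  set R : H2 →L[ℂ] H2 := T ∘L S.starProjection with hR
  have hle : LinearMap.range R.toLinearMap ≤ Submodule.map T.toLinearMap S := by
    rintro _ ⟨x, rfl⟩
    exact ⟨S.starProjection x, Submodule.starProjection_apply_mem _ _, rfl⟩
  have hfd : FiniteDimensional ℂ (LinearMap.range R.toLinearMap) :=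
    Submodule.finiteDimensional_of_le hle
  have hTR : ‖T - R‖ ≤ B := by
    apply ContinuousLinearMap.opNorm_le_bound _ hB
    intro x
    have e : (T - R) x = T (x - S.starProjection x) := by
      simp [hR]
    rw [e]
    have horth : x - S.starProjection x ∈ Sᗮ := Submodule.sub_starProjection_mem_orthogonal x
    have h1 := h (x - S.starProjection x) (fun i =>
      (Submodule.mem_orthogonal _ _).1 horth _ (Submodule.subset_span ⟨i, rfl⟩))
    have h2 : ‖x - S.starProjection x‖ ≤ ‖x‖ := by
      have e2 : x - S.starProjection x = Sᗮ.starProjection x := by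
        rw [Submodule.starProjection_orthogonal_val]
      rw [e2]
      exact Submodule.norm_starProjection_apply_le _ x
    exact h1.trans (by gcongr)
  unfold approxNum
  refine le_trans (csInf_le ⟨0, ?_⟩ ⟨R, hfd, ?_, rfl⟩) hTR
  · rintro _ ⟨R, _, _, rfl⟩; exact norm_nonneg _
  · exact (Submodule.finrank_mono hle).trans ((Submodule.finrank_map_le _ _).trans (hfS.trans hn))

lemma geom_tail (f : ℕ → ℂ) (s : ℂ) (hs : HasSum f s) (M : ℕ) (h0 : ∀ k < M, f k = 0)
    (A q : ℝ) (hq0 : 0 ≤ q) (hq1 : q < 1) (hb : ∀ k, ‖f k‖ ≤ A * q ^ k) :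
    ‖s‖ ≤ A * q ^ M / (1 - q) := by
  have h1 : HasSum (fun k => f (k + M)) s := by
    rw [hasSum_nat_add_iff]
    rw [Finset.sum_eq_zero (fun i hi => h0 i (Finset.mem_range.1 hi)), add_zero]
    exact hs
  have h2 : HasSum (fun k : ℕ => (A * q ^ M) * q ^ k) ((A * q ^ M) * (1 - q)⁻¹) :=
    (hasSum_geometric_of_lt_one hq0 hq1).mul_left _
  have h3 : ‖s‖ ≤ (A * q ^ M) * (1 - q)⁻¹ := by
    refine h1.norm_le_of_bounded h2 (fun k => ?_)
    refine (hb (k + M)).trans (le_of_eq ?_)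
    ring
  rwa [div_eq_mul_inv]

lemma coef_constraints (M : ℕ) : ∃ y : Fin M → H2, ∀ b : H2, (∀ i, inner ℂ (y i) b = 0) →
    ∀ (ζ : ℂ) (ρ : ℝ), ‖ζ‖ ≤ ρ → ρ < 1 → ‖fa b ζ‖ ≤ ‖b‖ * ρ ^ M / (1 - ρ) := by
  classical
  refine ⟨fun i => lp.single 2 (i:ℕ) 1, fun b hb ζ ρ h1 h2 => ?_⟩
  have hζ : ‖ζ‖ < 1 := h1.trans_lt h2
  refine geom_tail _ _ (fa_hasSum b ζ hζ) M ?_ ‖b‖ ρ ((norm_nonneg _).trans h1) h2 ?_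
  · intro k hk
    have := hb ⟨k, hk⟩
    rw [lp.inner_single_left] at this
    simp at this
    simp [this]
  · intro k
    rw [norm_mul, norm_pow]
    have := H2_coef_le b k
    gcongr

lemma taylor_constraints (w : ℂ) (hw : ‖w‖ < 1) (M : ℕ) : ∃ y : Fin M → H2, ∀ b : H2,
    (∀ i, inner ℂ (y i) b = 0) → ∀ ζ : ℂ, ‖ζ - w‖ ≤ (1 - ‖w‖) / 4 →
    ‖fa b ζ‖ ^ 2 ≤ 8 * (1 / 4) ^ M * ‖b‖ ^ 2 / (1 - ‖w‖) := by
  set R : ℝ := (1 - ‖w‖) / 2 with hR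
  have hRpos : 0 < R := by rw [hR]; linarith
  have hin : ∀ ζ : ℂ, ‖ζ - w‖ ≤ R → ‖ζ‖ < 1 ∧ 1 - ‖w‖ ≤ 2 * (1 - ‖ζ‖ ^ 2) := by
    intro ζ hζ
    have h1 : ‖ζ‖ ≤ ‖ζ - w‖ + ‖w‖ := by
      simpa using norm_add_le (ζ - w) w
    have h2 : ‖ζ‖ ≤ (1 + ‖w‖) / 2 := by rw [hR] at hζ; linarith
    refine ⟨by linarith, ?_⟩
    have := norm_nonneg ζ
    nlinarith
  have hsub : Metric.closedBall w R ⊆ Metric.ball 0 1 := by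
    intro ζ hζ
    rw [mem_closedBall_iff_norm] at hζ
    simpa using (hin ζ hζ).1
  have hwb : Metric.ball (0:ℂ) 1 ∈ nhds w := Metric.isOpen_ball.mem_nhds (by simpa using hw)
  have hcd : ∀ (b : H2) (k : ℕ), ContDiffAt ℂ k (fa b) w := fun b k =>
    ((fa_diff b).analyticAt hwb).contDiffAt
  set K : ℝ := Real.sqrt (2 / (1 - ‖w‖)) with hK
  have hbd : ∀ b : H2, ∀ ζ ∈ Metric.sphere w R, ‖fa b ζ‖ ≤ K * ‖b‖ := by
    intro b ζ hζ
    have hζ' : ‖ζ - w‖ ≤ R := by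
      rw [mem_sphere_iff_norm] at hζ; exact hζ.le
    obtain ⟨h1, h2⟩ := hin ζ hζ'
    have h3 := norm_fa_sq_le b ζ h1
    have h4 : ‖fa b ζ‖ ^ 2 ≤ (K * ‖b‖) ^ 2 := by
      rw [mul_pow, hK, Real.sq_sqrt (div_nonneg (by norm_num) (by linarith))]
      refine h3.trans ?_
      rw [div_mul_eq_mul_div, div_le_div_iff₀ (by nlinarith) (by linarith)]
      nlinarith [sq_nonneg ‖b‖]
    exact abs_le_of_sq_le_sq' h4 (by positivity) |>.2
  have hder : ∀ (b : H2) (k : ℕ), ‖iteratedDeriv k (fa b) w‖ ≤ k.factorial * (K * ‖b‖) / R ^ k := by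
    intro b k
    refine norm_iteratedDeriv_le_of_forall_mem_sphere_norm_le k hRpos ?_ (hbd b)
    exact ((fa_diff b).mono hsub).diffContOnCl_ball le_rfl
  let lin : ∀ k : ℕ, H2 →ₗ[ℂ] ℂ := fun k =>
    { toFun := fun b => iteratedDeriv k (fa b) w
      map_add' := by
        intro a b
        have e : fa (a + b) =ᶠ[nhds w] (fa a + fa b) := by
          filter_upwards [hwb] with z hz
          exact fa_add a b z (by simpa using hz)
        rw [e.iteratedDeriv_eq k, iteratedDeriv_add (hcd a k) (hcd b k)]
      map_smul' := by
        intro c b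
        have e : fa (c • b) =ᶠ[nhds w] (fun z => c * fa b z) := by
          filter_upwards [hwb] with z hz
          exact fa_smul c b z (by simpa using hz)
        rw [e.iteratedDeriv_eq k, iteratedDeriv_const_mul_field]
        simp }
  let clm : ∀ k : ℕ, H2 →L[ℂ] ℂ := fun k =>
    (lin k).mkContinuous (k.factorial * K / R ^ k) (by
      intro b
      refine (hder b k).trans (le_of_eq ?_)
      ring)
  refine ⟨fun i => (InnerProductSpace.toDual ℂ H2).symm (clm i), fun b hb ζ hζ => ?_⟩
  have hz : ∀ k < M, iteratedDeriv k (fa b) w = 0 := by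
    intro k hk
    have := hb ⟨k, hk⟩
    rw [InnerProductSpace.toDual_symm_apply] at this
    exact this
  have hball : DifferentiableOn ℂ (fa b) (Metric.ball w R) :=
    (fa_diff b).mono (Metric.ball_subset_closedBall.trans hsub)
  have hζR : ‖ζ - w‖ ≤ R / 2 := by rw [hR]; linarith
  have hs := Complex.hasSum_taylorSeries_on_ball hball (z := ζ) (by
    rw [mem_ball_iff_norm]; linarith)
  have h1 := geom_tail _ _ hs M (by
    intro k hk
    simp [hz k hk]) (K * ‖b‖) (1 / 2) (by norm_num) (by norm_num) (by
    intro k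
    rw [norm_smul, norm_smul, norm_inv, norm_pow, Complex.norm_natCast]
    have hk : (0:ℝ) < k.factorial := by exact_mod_cast k.factorial_pos
    calc (k.factorial:ℝ)⁻¹ * (‖ζ - w‖ ^ k * ‖iteratedDeriv k (fa b) w‖)
        ≤ (k.factorial:ℝ)⁻¹ * ((R / 2) ^ k * (k.factorial * (K * ‖b‖) / R ^ k)) := by
          have := hder b k
          gcongr
      _ = K * ‖b‖ * (1 / 2) ^ k := by
          rw [div_pow, one_div, inv_pow]; field_simp)
  have h2 : ‖fa b ζ‖ ^ 2 ≤ (K * ‖b‖ * (1 / 2) ^ M / (1 - 1 / 2)) ^ 2 := by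
    gcongr
  refine h2.trans (le_of_eq ?_)
  have e : ((1:ℝ) / 4) ^ M = ((1 / 2) ^ M) ^ 2 := by
    rw [← pow_mul, mul_comm M 2, pow_mul]; norm_num
  rw [e, div_pow, mul_pow, mul_pow, hK, Real.sq_sqrt (div_nonneg (by norm_num) (by linarith))]
  have : (1 - ‖w‖) ≠ 0 := by linarith
  field_simp
  ring

lemma polar_dist (r s a b : ℝ) (hr0 : 0 ≤ r) (hr : r ≤ 1) :
    ‖(r : ℂ) * Complex.exp (a * I) - (s : ℂ) * Complex.exp (b * I)‖ ≤ |r - s| + |a - b| := by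
  have e : (r : ℂ) * Complex.exp (a * I) - (s : ℂ) * Complex.exp (b * I)
      = (r : ℂ) * Complex.exp (b * I) * (Complex.exp (I * ((a - b : ℝ) : ℂ)) - 1)
        + ((r - s : ℝ) : ℂ) * Complex.exp (b * I) := by
    have : Complex.exp (a * I) = Complex.exp (b * I) * Complex.exp (I * ((a - b : ℝ) : ℂ)) := by
      rw [← Complex.exp_add]; congr 1; push_cast; ring
    rw [this]; push_cast; ring
  rw [e]
  refine (norm_add_le _ _).trans ?_
  rw [norm_mul, norm_mul, norm_mul, Complex.norm_exp_ofReal_mul_I, Complex.norm_real,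
    Complex.norm_real, Real.norm_eq_abs, Real.norm_eq_abs, abs_of_nonneg hr0, mul_one, mul_one]
  have h1 : ‖Complex.exp (I * ((a - b : ℝ) : ℂ)) - 1‖ ≤ |a - b| :=
    Real.norm_exp_I_mul_ofReal_sub_one_le
  have h2 : r * ‖Complex.exp (I * ((a - b : ℝ) : ℂ)) - 1‖ ≤ 1 * |a - b| := by gcongr
  linarith

lemma circle_split (φ : ℂ → ℂ) (hφ : DifferentiableOn ℂ φ (Metric.ball 0 1))
    (hm : ∀ z, ‖z‖ < 1 → ‖φ z‖ < 1) (b : H2) (r δ E : ℝ) (hr1 : r < 1) (hδ0 : 0 < δ)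
    (hδ : δ ≤ 1 / 4) (hr : 1 - r ≤ δ / 2) (hE : 0 ≤ E)
    (hout : ∀ θ, -Real.pi ≤ θ → θ ≤ Real.pi → 2 * δ ≤ |θ| →
      ‖fa b (φ ((r : ℂ) * Complex.exp (θ * I)))‖ ^ 2 ≤ E) :
    Real.circleAverage (fun z => ‖fa b (φ z)‖ ^ 2) 0 r ≤
      18 * δ * (4 / (1 - ‖φ ((1 - δ : ℝ) : ℂ)‖) * ‖b‖ ^ 2) + E := by
  set a : ℂ := ((1 - δ : ℝ) : ℂ) with hadef
  have hna : ‖a‖ = 1 - δ := by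
    rw [hadef, Complex.norm_real, Real.norm_eq_abs, abs_of_nonneg (by linarith)]
  have hr0 : 0 < r := by linarith
  have har : ‖a‖ < r := by rw [hna]; linarith
  have hsub : Metric.closedBall (0:ℂ) r ⊆ Metric.ball 0 1 := Metric.closedBall_subset_ball hr1
  have hsph : ∀ z ∈ Metric.sphere (0:ℂ) |r|, z ∈ Metric.closedBall (0:ℂ) r := by
    intro z hz; rw [abs_of_pos hr0] at hz; exact Metric.sphere_subset_closedBall hz
  have hkc : ContinuousOn (poissonKernel 0 a) (Metric.sphere (0:ℂ) |r|) := by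
    unfold poissonKernel
    apply ContinuousOn.div (by fun_prop) (by fun_prop)
    intro z hz h0
    rw [abs_of_pos hr0] at hz
    simp [sub_eq_zero] at h0 hz
    rw [h0] at hz; linarith
  have hk0 : ∀ z ∈ Metric.sphere (0:ℂ) |r|, 0 ≤ poissonKernel 0 a z := by
    intro z hz
    rw [abs_of_pos hr0] at hz
    simp at hz
    unfold poissonKernel
    simp only [sub_zero]
    refine div_nonneg ?_ (by positivity)
    rw [hz]; nlinarith [norm_nonneg a]
  have hc1 : ContinuousOn (fun z => ‖fa b (φ z)‖ ^ 2) (Metric.sphere (0:ℂ) |r|) := by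
    have : ContinuousOn (fun z => fa b (φ z)) (Metric.closedBall 0 r) :=
      ContinuousOn.comp (fa_cont b) (hφ.continuousOn.mono hsub)
        (fun z hz => by simpa using hm z (by simpa using hsub hz))
    exact (this.mono hsph).norm.pow 2
  have hi2 : CircleIntegrable (fun z => 18 * δ * (poissonKernel 0 a z * ‖fa b (φ z)‖ ^ 2)) 0 r :=
    (continuousOn_const.mul (hkc.mul hc1)).circleIntegrable'
  have hs := subordination φ hφ hm b r hr1 a har
  calc Real.circleAverage (fun z => ‖fa b (φ z)‖ ^ 2) 0 r
      ≤ Real.circleAverage (fun z => 18 * δ * (poissonKernel 0 a z * ‖fa b (φ z)‖ ^ 2) + E) 0 r := by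
        apply Real.circleAverage_mono
        · exact hc1.circleIntegrable'
        · exact ((continuousOn_const.mul (hkc.mul hc1)).add continuousOn_const).circleIntegrable'
        · intro z hz
          have hP := hk0 z hz
          have hzr : ‖z‖ = r := by simpa [abs_of_pos hr0] using hz
          have ez : (r : ℂ) * Complex.exp (z.arg * I) = z := by
            rw [← hzr]; exact Complex.norm_mul_exp_arg_mul_I z
          by_cases h2 : 2 * δ ≤ |z.arg|
          · have := hout z.arg (Complex.neg_pi_lt_arg z).le (Complex.arg_le_pi z) h2
            rw [ez] at this
            have : 0 ≤ 18 * δ * (poissonKernel 0 a z * ‖fa b (φ z)‖ ^ 2) := by positivity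
            linarith
          · push Not at h2
            have hd : ‖z - a‖ ≤ 3 * δ := by
              have := polar_dist r (1 - δ) z.arg 0 hr0.le hr1.le
              rw [ez] at this
              simp only [ofReal_zero, zero_mul, Complex.exp_zero, mul_one, sub_zero] at this
              refine this.trans ?_
              have : |r - (1 - δ)| ≤ δ := by rw [abs_le]; constructor <;> linarith
              linarith
            have hdpos : 0 < ‖z - a‖ := by
              rw [norm_pos_iff, sub_ne_zero]; rintro h
              rw [h] at hzr; linarith
            have hge : 1 ≤ 18 * δ * poissonKernel 0 a z := by
              unfold poissonKernel
              simp only [sub_zero]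
              rw [← mul_div_assoc, le_div_iff₀ (by positivity), hzr, hna]
              have h3 : ‖z - a‖ ^ 2 ≤ (3 * δ) ^ 2 := by gcongr
              have h4 : δ / 2 ≤ r ^ 2 - (1 - δ) ^ 2 := by nlinarith
              nlinarith
            have : ‖fa b (φ z)‖ ^ 2 * 1 ≤ ‖fa b (φ z)‖ ^ 2 * (18 * δ * poissonKernel 0 a z) := by
              gcongr
            nlinarith
    _ = 18 * δ * Real.circleAverage (fun z => poissonKernel 0 a z * ‖fa b (φ z)‖ ^ 2) 0 r + E := by
        rw [Real.circleAverage_fun_add hi2 (circleIntegrable_const E 0 r), Real.circleAverage_const]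
        congr 1
        have := Real.circleAverage_fun_smul (f := fun z => poissonKernel 0 a z * ‖fa b (φ z)‖ ^ 2)
          (c := 0) (R := r) (a := 18 * δ)
        simpa only [smul_eq_mul] using this
    _ ≤ _ := by gcongr

lemma poisson_sign {U : ℝ → ℝ} (he : ∀ t, U (-t) = U t) (r θ : ℝ) :
    poisson U r |θ| = poisson U r θ := by
  rcases abs_choice θ with h | h
  · rw [h]
  · rw [h, poisson_even he]

lemma far_point {U : ℝ → ℝ} (hK : ClassU U) {F φ : ℂ → ℂ}
    (hFre : ∀ r θ : ℝ, 0 ≤ r → r < 1 →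
      (F ((r : ℂ) * Complex.exp (θ * Complex.I))).re = poisson U r θ)
    (hφ : ∀ z, φ z = Complex.exp (-F z)) (r θ t : ℝ) (ht : 0 < t) (h0 : 0 ≤ r) (h1 : r < 1)
    (hr : 1 - r ≤ t / 2) (hθ : t ≤ |θ|) (hpi : |θ| ≤ Real.pi) :
    ‖φ ((r : ℂ) * Complex.exp (θ * Complex.I))‖ ≤ Real.exp (-(U (t / 2) / (4 * Real.pi))) := by
  rw [phi_norm hFre hφ r θ h0 h1, ← poisson_sign hK.2.1 r θ]
  have hp := Real.pi_pos
  apply Real.exp_le_exp.2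
  have := poisson_lower1 hK r |θ| h0 h1 (by linarith) hpi
  have h2 : U (t / 2) ≤ U (|θ| - (1 - r)) :=
    hK.2.2.2.2.1 ⟨by linarith, by linarith⟩ ⟨by linarith, by linarith⟩ (by linarith)
  have h3 : U (t / 2) / (4 * Real.pi) ≤ U (|θ| - (1 - r)) / (4 * Real.pi) := by gcongr
  linarith

lemma lip_sign {U : ℝ → ℝ} (he : ∀ t, U (-t) = U t) (B θ : ℝ)
    (h : ∀ x ∈ Icc (-Real.pi) Real.pi,
        |U x - U (|θ|)| ≤ B * ‖circleMap 0 1 x - circleMap 0 1 (|θ|)‖) :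
    ∀ x ∈ Icc (-Real.pi) Real.pi, |U x - U θ| ≤ B * ‖circleMap 0 1 x - circleMap 0 1 θ‖ := by
  rcases abs_choice θ with h' | h'
  · rwa [h'] at h
  · rw [h'] at h
    intro x hx
    have := h (-x) ⟨by linarith [hx.2], by linarith [hx.1]⟩
    rw [he, he] at this
    have e : ‖circleMap 0 1 (-x) - circleMap 0 1 (-θ)‖ = ‖circleMap 0 1 x - circleMap 0 1 θ‖ := by
      have h1 := norm_circle_sub_sq 1 (-θ) (-x)
      have h2 := norm_circle_sub_sq 1 θ x
      rw [ofReal_one, one_mul, ← circleMap_one] at h1 h2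
      rw [show -θ - -x = -(θ - x) by ring, Real.cos_neg, ← h2] at h1
      exact (pow_left_inj₀ (norm_nonneg _) (norm_nonneg _) (by norm_num)).1 h1
    rwa [e] at this

lemma mid_weight {U : ℝ → ℝ} (hK : ClassU U) {F φ : ℂ → ℂ} {L₁ K C : ℝ} {p : ℕ}
    (hA : Analytic1 U L₁ K C p)
    (hFre : ∀ r θ : ℝ, 0 ≤ r → r < 1 →
      (F ((r : ℂ) * Complex.exp (θ * Complex.I))).re = poisson U r θ)
    (hφ : ∀ z, φ z = Complex.exp (-F z)) (L τ ε σ : ℝ) (hL : L₁ ≤ L)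
    (h1 : 2 * Real.exp (-L) ≤ τ) (h2 : τ ≤ Real.exp (-L₁) / 2) (hε0 : 0 < ε) (hε : ε ≤ 1 / 2)
    (hσ : |σ| = τ) :
    τ / (64 * K * L ^ p) ≤
      1 - ‖φ (((1 - ε * τ : ℝ) : ℂ) * Complex.exp (σ * Complex.I))‖ := by
  have hpi := Real.pi_gt_three
  have hpi4 := Real.pi_lt_four
  have hL3 := hA.hL
  have hK1 := hA.hK1
  have hτ : 0 < τ := lt_of_lt_of_le (by positivity) h1
  have ht1 : Real.exp (-L₁) < 1 := exp_neg_lt_one (by linarith)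
  have hετ : ε * τ ≤ τ / 2 := by nlinarith
  have hετ0 : 0 < ε * τ := by positivity
  rw [phi_norm hFre hφ _ _ (by linarith) (by linarith), ← poisson_sign hK.2.1, hσ]
  have h3 := poisson_lower1 hK (1 - ε * τ) τ (by linarith) (by linarith) (by linarith) (by linarith)
  have h4 : U (τ / 2) ≤ U (τ - (1 - (1 - ε * τ))) :=
    hK.2.2.2.2.1 ⟨by linarith, by linarith⟩ ⟨by linarith, by linarith⟩ (by linarith)
  set L' := -Real.log (τ / 2) with hL'
  have eL' : Real.exp (-L') = τ / 2 := by rw [hL', neg_neg, Real.exp_log (by positivity)]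
  have hL'1 : L₁ ≤ L' := by
    have : Real.exp (-L') ≤ Real.exp (-L₁) := by rw [eL']; linarith
    have := Real.exp_le_exp.1 this; linarith
  have hL'2 : L' ≤ L := by
    have : Real.exp (-L) ≤ Real.exp (-L') := by rw [eL']; linarith
    have := Real.exp_le_exp.1 this; linarith
  have h5 := hA.Uge L' hL'1
  rw [eL'] at h5
  have hUpos : 0 < U (τ / 2) := hK.2.2.2.2.2.1 _ (by linarith) (by linarith)
  have h6 : τ / 2 ≤ K * L ^ p * U (τ / 2) := by
    refine h5.trans ?_
    have : 0 ≤ L' := by linarith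
    gcongr
  set P := poisson U (1 - ε * τ) τ with hP
  have h7 : τ / (32 * K * L ^ p) ≤ P := by
    refine le_trans ?_ h3
    have hKL : 0 < K * L ^ p := mul_pos (by linarith) (pow_pos (by linarith) _)
    rw [div_le_div_iff₀ (by nlinarith) (by linarith)]
    have h8 : τ ≤ 2 * (K * L ^ p * U (τ - (1 - (1 - ε * τ)))) := by
      have : K * L ^ p * U (τ / 2) ≤ K * L ^ p * U (τ - (1 - (1 - ε * τ))) := by gcongr
      linarith
    nlinarith
  have hKL : 1 ≤ K * L ^ p := by
    have : 1 ≤ L ^ p := one_le_pow₀ (by linarith)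
    nlinarith
  set v := τ / (32 * K * L ^ p) with hv
  have hv0 : 0 ≤ v := by
    rw [hv]; apply div_nonneg hτ.le; nlinarith
  have hv1 : v ≤ 1 := by
    rw [hv, div_le_one (by nlinarith)]; nlinarith
  have e : τ / (64 * K * L ^ p) = v / 2 := by
    rw [hv, div_div]; congr 1; ring
  rw [e]
  have h9 : Real.exp (-P) ≤ Real.exp (-v) := Real.exp_le_exp.2 (by linarith)
  have h10 : Real.exp (-v) ≤ 1 - v / 2 := by
    have ha : |(-v)| ≤ 1 := by rw [abs_neg, abs_of_nonneg hv0]; exact hv1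
    have := Real.add_one_le_exp v
    rw [Real.exp_neg]
    rw [inv_le_comm₀ (Real.exp_pos _) (by linarith)]
    refine le_trans ?_ this
    rw [inv_le_comm₀ (by linarith) (by linarith), ← one_div, div_le_iff₀ (by linarith)]
    nlinarith
  linarith

lemma mid_point {U : ℝ → ℝ} (hK : ClassU U) {F φ : ℂ → ℂ} {L₁ K C : ℝ} {p : ℕ}
    (hA : Analytic1 U L₁ K C p) (hF : DifferentiableOn ℂ F (Metric.ball 0 1))
    (hFre : ∀ r θ : ℝ, 0 ≤ r → r < 1 →
      (F ((r : ℂ) * Complex.exp (θ * Complex.I))).re = poisson U r θ)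
    (hφ : ∀ z, φ z = Complex.exp (-F z)) (K₃ : ℝ) (hK₃ : 0 < K₃)
    (hlip : ∀ L θ, L₁ ≤ L → 2 * Real.exp (-L) ≤ θ → θ ≤ Real.exp (-L₁) / 2 →
      ∀ x ∈ Icc (-Real.pi) Real.pi,
        |U x - U θ| ≤ K₃ * L * ‖circleMap 0 1 x - circleMap 0 1 θ‖)
    (L τ ε σ r θ : ℝ) (hL : L₁ ≤ L)
    (h1 : 2 * Real.exp (-L) ≤ τ) (h2 : |θ| ≤ Real.exp (-L₁) / 2) (hε0 : 0 < ε) (hε : ε ≤ 1 / 2)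
    (hσ : |σ| = τ) (hr0 : 0 ≤ r) (hr1 : r < 1) (hr : 1 - r ≤ ε * τ)
    (hθ : τ ≤ |θ|) (hθσ : |θ - σ| ≤ ε * τ) (hlog : Real.log (5 / (ε * τ)) ≤ 2 * L)
    (hεK : 72 * 256 * K₃ * K * L ^ (p + 2) * ε ≤ 1) :
    ‖φ ((r : ℂ) * Complex.exp (θ * I)) - φ (((1 - ε * τ : ℝ) : ℂ) * Complex.exp (σ * I))‖ ≤
      (1 - ‖φ (((1 - ε * τ : ℝ) : ℂ) * Complex.exp (σ * I))‖) / 4 := by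
  have hL3 := hA.hL
  have hK1 := hA.hK1
  have hτ : 0 < τ := lt_of_lt_of_le (by positivity) h1
  have ht1 : Real.exp (-L₁) < 1 := exp_neg_lt_one (by linarith)
  have hετ : ε * τ ≤ τ / 2 := by nlinarith
  have hετ0 : 0 < ε * τ := by positivity
  have hw := mid_weight hK hA hFre hφ L τ ε σ hL h1 (hθ.trans h2) hε0 hε hσ
  have hF1 := F_diff_main hK.1 hK.2.2.1 F hF hFre (K₃ * L) r θ (ε * τ) σ hr0 hr1 hετ0 (by linarith)
    (by nlinarith) (lip_sign hK.2.1 _ _ (hlip L |θ| hL (h1.trans hθ) h2))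
  have hd := polar_dist r (1 - ε * τ) θ σ hr0 hr1.le
  have hd2 : |r - (1 - ε * τ)| ≤ ε * τ := by rw [abs_le]; constructor <;> linarith
  set z := (r : ℂ) * Complex.exp (θ * I) with hz
  set z' := ((1 - ε * τ : ℝ) : ℂ) * Complex.exp (σ * I) with hz'
  have hL0 : 0 < L := by linarith
  have hF2 : ‖F z - F z'‖ ≤ 36 * K₃ * L ^ 2 * (ε * τ) := by
    calc ‖F z - F z'‖ ≤ 6 * (K₃ * L) * ‖z - z'‖ * Real.log (5 / (ε * τ)) := hF1
      _ ≤ 6 * (K₃ * L) * ‖z - z'‖ * (2 * L) := by gcongr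
      _ ≤ 6 * (K₃ * L) * (2 * (ε * τ)) * (2 * L) := by
          have : ‖z - z'‖ ≤ 2 * (ε * τ) := by linarith
          gcongr
      _ ≤ _ := by
          have : 0 < K₃ * L ^ 2 * (ε * τ) := by positivity
          nlinarith
  have hLp : 1 ≤ L ^ p := one_le_pow₀ (by linarith)
  have hKL : 1 ≤ K * L ^ p := by nlinarith
  have hbase : 72 * K₃ * L ^ 2 * (ε * τ) ≤ τ / (64 * K * L ^ p) / 4 := by
    rw [div_div, le_div_iff₀ (by positivity)]
    calc 72 * K₃ * L ^ 2 * (ε * τ) * (64 * K * L ^ p * 4)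
        = 72 * 256 * K₃ * K * L ^ (p + 2) * ε * τ := by ring
      _ ≤ 1 * τ := by gcongr
      _ = τ := one_mul _
  have hsmall : ‖F z' - F z‖ ≤ 1 := by
    rw [norm_sub_rev]
    have : τ / (64 * K * L ^ p) ≤ 1 := by
      rw [div_le_one (by positivity)]; nlinarith
    linarith
  have e : φ z - φ z' = φ z' * (Complex.exp (F z' - F z) - 1) := by
    rw [hφ z, hφ z', mul_sub, ← Complex.exp_add, mul_one]; congr 2; ring
  have hlt : ‖φ z'‖ ≤ 1 := by
    have : 0 ≤ τ / (64 * K * L ^ p) := by positivity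
    linarith
  have h5 := Complex.norm_exp_sub_one_le hsmall
  rw [e, norm_mul]
  calc ‖φ z'‖ * ‖Complex.exp (F z' - F z) - 1‖ ≤ 1 * (2 * ‖F z' - F z‖) := by gcongr
    _ ≤ (1 - ‖φ z'‖) / 4 := by
      rw [norm_sub_rev]; linarith

lemma grid_pow (ε L : ℝ) (J : ℕ) (hε0 : 0 < ε) (hε : ε ≤ 1) (hJ : 2 * L ≤ J * ε) :
    Real.exp L ≤ (1 + ε) ^ J := by
  have h1 : Real.exp (ε / 2) ≤ 1 + ε := by
    have h := Real.add_one_le_exp (-(ε / 2))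
    rw [Real.exp_neg] at h
    have hp := Real.exp_pos (ε / 2)
    have h3 : Real.exp (ε / 2) * (-(ε / 2) + 1) ≤ 1 := by
      calc _ ≤ Real.exp (ε / 2) * (Real.exp (ε / 2))⁻¹ := by gcongr
        _ = 1 := mul_inv_cancel₀ hp.ne'
    have h4 : 1 ≤ (1 + ε) * (-(ε / 2) + 1) := by nlinarith
    have h5 : 0 < -(ε / 2) + 1 := by linarith
    nlinarith
  calc Real.exp L ≤ Real.exp (J * (ε / 2)) := Real.exp_le_exp.2 (by linarith)
    _ = Real.exp (ε / 2) ^ J := by rw [Real.exp_nat_mul]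
    _ ≤ (1 + ε) ^ J := by gcongr

set_option maxHeartbeats 4000000 in
lemma upper_fixed {U : ℝ → ℝ} (hK : ClassU U) {F φ : ℂ → ℂ} {L₁ K C : ℝ} {p : ℕ}
    (hA : Analytic1 U L₁ K C p) (hF : DifferentiableOn ℂ F (Metric.ball 0 1))
    (hFre : ∀ r θ : ℝ, 0 ≤ r → r < 1 →
      (F ((r : ℂ) * Complex.exp (θ * Complex.I))).re = poisson U r θ)
    (hφ : ∀ z, φ z = Complex.exp (-F z)) (T : H2 →L[ℂ] H2)
    (hT : ∀ (a : H2) (z : ℂ), ‖z‖ < 1 → fa (T a) z = fa a (φ z)) (K₃ : ℝ) (hK₃ : 0 < K₃)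
    (hlip : ∀ L θ, L₁ ≤ L → 2 * Real.exp (-L) ≤ θ → θ ≤ Real.exp (-L₁) / 2 →
      ∀ x ∈ Icc (-Real.pi) Real.pi,
        |U x - U θ| ≤ K₃ * L * ‖circleMap 0 1 x - circleMap 0 1 θ‖)
    (A L : ℕ) (hA2 : 2 ≤ A) (hAK : 72 * 256 * K₃ * K ≤ A) (hL : L₁ ≤ L)
    (hrad : Real.exp (-(L:ℝ)) * HL U L / 32 ≤ 1 - ‖φ ((1 - Real.exp (-(L:ℝ)) : ℝ) : ℂ)‖)
    (hE1 : 5 * A * (L:ℝ) ^ (p + 2) * Real.exp (-(L:ℝ)) ≤ 1)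
    (hE2 : 256 * K ^ 2 * (L:ℝ) ^ (p + 1) * Real.exp (-(L:ℝ)) ≤ 1)
    (ρ : ℝ) (hρ : ρ = Real.exp (-(U (Real.exp (-L₁) / 2 / 2) / (4 * Real.pi))))
    (hE3 : K * L * (ρ ^ 2) ^ L ≤ (1 - ρ) ^ 2)
    (n : ℕ) (hn : (8 * A + 1) * L ^ (p + 4) ≤ n - 1) :
    approxNum T n ≤ Real.sqrt (2305 / HL U L) := by
  have hpi := Real.pi_gt_three
  have hL3 := hA.hL
  have hK1 := hA.hK1
  have hL0 : (0:ℝ) < L := by linarith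
  have hL1' : (1:ℝ) ≤ L := by linarith
  have hLN : 1 ≤ L := by exact_mod_cast hL1'
  have hA0 : (2:ℝ) ≤ A := by exact_mod_cast hA2
  obtain ⟨δ, hδ⟩ : ∃ δ, δ = Real.exp (-(L:ℝ)) := ⟨_, rfl⟩
  obtain ⟨t₂, ht₂⟩ : ∃ t₂, t₂ = Real.exp (-L₁) / 2 := ⟨_, rfl⟩
  obtain ⟨H, hH⟩ : ∃ H, H = HL U L := ⟨_, rfl⟩
  have hδ0 : 0 < δ := by rw [hδ]; positivity
  have ht0 : 0 < t₂ := by rw [ht₂]; positivity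
  have ht1 : t₂ < 1 / 2 := by
    have : Real.exp (-L₁) < 1 := exp_neg_lt_one (by linarith)
    linarith
  have hH1 : 1 ≤ H := by rw [hH]; exact hA.one_le _ hL
  have hHK : H ≤ K * L := by rw [hH]; exact hA.lin _ hL
  have hδ4 : δ ≤ 1 / 4 := by
    have h := Real.add_one_le_exp (L:ℝ)
    rw [hδ, Real.exp_neg, inv_le_comm₀ (Real.exp_pos _) (by norm_num)]
    norm_num; linarith
  have hpow1 : (1:ℝ) ≤ (L:ℝ) ^ (p + 2) := one_le_pow₀ hL1'
  obtain ⟨ε, hε⟩ : ∃ ε : ℝ, ε = 1 / (A * (L:ℝ) ^ (p + 2)) := ⟨_, rfl⟩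
  have hεden : (2:ℝ) ≤ A * (L:ℝ) ^ (p + 2) := by nlinarith
  have hε0 : 0 < ε := by rw [hε]; positivity
  have hε2 : ε ≤ 1 / 2 := by
    rw [hε]; exact one_div_le_one_div_of_le (by norm_num) hεden
  have hεmul : A * (L:ℝ) ^ (p + 2) * ε = 1 := by rw [hε]; field_simp
  have hεK : 72 * 256 * K₃ * K * (L:ℝ) ^ (p + 2) * ε ≤ 1 := by
    rw [← hεmul]; gcongr
  obtain ⟨J, hJ⟩ : ∃ J : ℕ, J = 2 * A * L ^ (p + 3) := ⟨_, rfl⟩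
  have hJε : 2 * (L:ℝ) ≤ J * ε := by
    rw [hJ]; push_cast
    have : (2:ℝ) * A * L ^ (p + 3) * ε = 2 * L * (A * (L:ℝ) ^ (p + 2) * ε) := by ring
    rw [this, hεmul, mul_one]
  have hgrid := grid_pow ε L J hε0 (by linarith) hJε
  set τ : ℕ → ℝ := fun j => 2 * δ * (1 + ε) ^ j with hτ
  have hτge : ∀ j, 2 * δ ≤ τ j := fun j => by
    have : 1 ≤ (1 + ε) ^ j := one_le_pow₀ (by linarith)
    simp only [hτ]; nlinarith
  set sg : Bool → ℝ := fun s => if s then 1 else -1 with hsg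
  set w : Fin J × Bool → ℂ := fun q =>
    φ (((1 - ε * τ q.1 : ℝ) : ℂ) * Complex.exp ((sg q.2 * τ q.1 : ℝ) * I)) with hw
  have hsgabs : ∀ s, |sg s| = 1 := by intro s; cases s <;> simp [hsg]
  have hstabs : ∀ s j, |sg s * τ j| = τ j := by
    intro s j
    rw [abs_mul, hsgabs, one_mul, abs_of_nonneg]; linarith [hτge j]
  have hweight : ∀ q : Fin J × Bool, τ q.1 ≤ t₂ → τ q.1 / (64 * K * (L:ℝ) ^ p) ≤ 1 - ‖w q‖ := by
    intro q hq
    refine mid_weight hK hA hFre hφ L (τ q.1) ε (sg q.2 * τ q.1) hL ?_ ?_ hε0 hε2 (hstabs _ _)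
    · rw [← hδ]; exact hτge _
    · rw [← ht₂]; exact hq
  have hex : ∀ q : Fin J × Bool, ∃ y : Fin (2 * L) → H2, ∀ b : H2, (∀ i, inner ℂ (y i) b = 0) →
      τ q.1 ≤ t₂ → ∀ ζ : ℂ, ‖ζ - w q‖ ≤ (1 - ‖w q‖) / 4 →
      ‖fa b ζ‖ ^ 2 ≤ 8 * (1 / 4) ^ (2 * L) * ‖b‖ ^ 2 / (1 - ‖w q‖) := by
    intro q
    by_cases hq : τ q.1 ≤ t₂
    · have h1 := hweight q hq
      have h2 : 0 < τ q.1 / (64 * K * (L:ℝ) ^ p) := by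
        have : 0 < τ q.1 := by linarith [hτge q.1]
        positivity
      obtain ⟨y, hy⟩ := taylor_constraints (w q) (by linarith) (2 * L)
      exact ⟨y, fun b hb _ => hy b hb⟩
    · exact ⟨fun _ => 0, fun b _ h => absurd h hq⟩
  choose Y hY using hex
  obtain ⟨y0, hy0⟩ := coef_constraints L
  refine approx_le T n (ι := Fin L ⊕ ((Fin J × Bool) × Fin (2 * L)))
    (Sum.elim y0 (fun q => Y q.1 q.2)) ?_ _ (Real.sqrt_nonneg _) ?_
  · refine le_trans (le_of_eq ?_) ((?_ : L + 8 * A * L ^ (p + 4) ≤ _).trans hn)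
    · simp [hJ]; ring
    · have : L ≤ L ^ (p + 4) := Nat.le_self_pow (by omega) L
      nlinarith
  intro b hb
  have hb0 : ∀ i, inner ℂ (y0 i) b = 0 := fun i => hb (Sum.inl i)
  have hbY : ∀ q i, inner ℂ (Y q i) b = 0 := fun q i => hb (Sum.inr (q, i))
  have hdiff := phi_diff hF hφ
  have hm := phi_lt hK hFre hφ
  have hsq : ‖T b‖ ^ 2 ≤ 2305 / H * ‖b‖ ^ 2 := by
    obtain ⟨m, hmdef⟩ : ∃ m, m = min (δ / 2) (min (2 * ε * δ) (t₂ / 2)) := ⟨_, rfl⟩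
    have hm1 : m ≤ δ / 2 := by rw [hmdef]; exact min_le_left _ _
    have hm2 : m ≤ 2 * ε * δ := by rw [hmdef]; exact (min_le_right _ _).trans (min_le_left _ _)
    have hm3 : m ≤ t₂ / 2 := by rw [hmdef]; exact (min_le_right _ _).trans (min_le_right _ _)
    have hm0 : 0 < m := by rw [hmdef]; refine lt_min ?_ (lt_min ?_ ?_) <;> positivity
    refine norm_sq_le_of_circle (T b) _ (1 - m) (by linarith) (fun r hr hr0 hr1 => ?_)
    have ecirc : Real.circleAverage (fun z => ‖fa (T b) z‖ ^ 2) 0 r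
        = Real.circleAverage (fun z => ‖fa b (φ z)‖ ^ 2) 0 r := by
      apply Real.circleAverage_congr_sphere
      intro z hz
      have : ‖z‖ = r := by simpa [abs_of_nonneg hr0] using hz
      simp only
      rw [hT b z (by linarith)]
    rw [ecirc]
    have hsplit := circle_split φ hdiff hm b r δ (‖b‖ ^ 2 / H) hr1 hδ0 hδ4 (by linarith)
      (by positivity) ?_
    · refine hsplit.trans ?_
      rw [← hδ, ← hH] at hrad
      have hp : 0 < δ * H / 32 := by positivity
      have h4 : 4 / (1 - ‖φ ((1 - δ : ℝ) : ℂ)‖) ≤ 4 / (δ * H / 32) := by gcongr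
      calc _ ≤ 18 * δ * (4 / (δ * H / 32) * ‖b‖ ^ 2) + ‖b‖ ^ 2 / H := by gcongr
        _ = 2305 / H * ‖b‖ ^ 2 := by
          have : H ≠ 0 := by positivity
          field_simp; ring
    · intro θ hθ1 hθ2 hθ3
      have hθpi : |θ| ≤ Real.pi := abs_le.2 ⟨hθ1, hθ2⟩
      rcases le_or_gt |θ| t₂ with hcase | hcase
      · obtain ⟨j, hj1, hj2⟩ := exists_nat_pow_near (x := |θ| / (2 * δ)) (y := 1 + ε)
          (by rw [le_div_iff₀ (by positivity)]; linarith) (by linarith)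
        rw [le_div_iff₀ (by positivity)] at hj1
        rw [div_lt_iff₀ (by positivity)] at hj2
        have hjJ : j < J := by
          by_contra hcon
          push Not at hcon
          have h1 : (1 + ε) ^ J ≤ (1 + ε) ^ j := pow_le_pow_right₀ (by linarith) hcon
          have h2 : Real.exp (L:ℝ) * δ = 1 := by
            rw [hδ, ← Real.exp_add]; simp
          have h3 : Real.exp (L:ℝ) * (2 * δ) ≤ (1 + ε) ^ j * (2 * δ) := by
            have := hgrid.trans h1
            gcongr
          linarith
        have hτj : τ j ≤ |θ| := by simp only [hτ]; linarith
        have hτj2 : |θ| ≤ τ j * (1 + ε) := by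
          simp only [hτ]; rw [pow_succ] at hj2; linarith
        obtain ⟨s, hs⟩ : ∃ s, θ = sg s * |θ| := by
          rcases le_total 0 θ with h | h
          · exact ⟨true, by simp [hsg, abs_of_nonneg h]⟩
          · exact ⟨false, by simp [hsg, abs_of_nonpos h]⟩
        have hclose : |θ - sg s * τ j| ≤ ε * τ j := by
          have : θ - sg s * τ j = sg s * (|θ| - τ j) := by
            rw [mul_sub, ← hs]
          rw [this, abs_mul, hsgabs, one_mul, abs_of_nonneg (by linarith)]
          linarith
        have hτ0 : 0 < τ j := by linarith [hτge j]
        have hlog : Real.log (5 / (ε * τ j)) ≤ 2 * L := by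
          rw [Real.log_le_iff_le_exp (by positivity), div_le_iff₀ (by positivity)]
          have h1 : Real.exp (2 * (L:ℝ)) * δ = Real.exp L := by
            rw [hδ, ← Real.exp_add]; ring_nf
          have h2 : 5 * A * (L:ℝ) ^ (p + 2) ≤ Real.exp L := by
            rw [Real.exp_neg, ← div_eq_mul_inv, div_le_one (Real.exp_pos _)] at hE1
            exact hE1
          have h3 : 5 ≤ Real.exp L * ε := by
            calc (5:ℝ) = 5 * A * (L:ℝ) ^ (p + 2) * ε := by
                  rw [show 5 * A * (L:ℝ) ^ (p + 2) * ε = 5 * (A * (L:ℝ) ^ (p + 2) * ε) by ring, hεmul]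
                  norm_num
              _ ≤ _ := by gcongr
          calc (5:ℝ) ≤ Real.exp L * ε := h3
            _ = Real.exp (2 * (L:ℝ)) * (ε * δ) := by rw [← h1]; ring
            _ ≤ Real.exp (2 * (L:ℝ)) * (ε * τ j) := by
                have : δ ≤ τ j := by linarith [hτge j]
                gcongr
        have hmid := mid_point hK hA hF hFre hφ K₃ hK₃ hlip L (τ j) ε (sg s * τ j) r θ hL
          (by rw [← hδ]; exact hτge j) (by rw [← ht₂]; exact hcase) hε0 hε2 (hstabs _ _) hr0 hr1
          (by nlinarith [hτge j]) hτj hclose hlog hεK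
        have hwt := hweight (⟨j, hjJ⟩, s) (hτj.trans hcase)
        have hfin := hY (⟨j, hjJ⟩, s) b (hbY _) (hτj.trans hcase) _ hmid
        refine hfin.trans ?_
        have hLp : 0 < (L:ℝ) ^ p := by positivity
        have hpos : 0 < τ j / (64 * K * (L:ℝ) ^ p) := by positivity
        have h16 : ((1:ℝ) / 4) ^ (2 * L) ≤ δ * δ := by
          have e1 : δ * δ = (Real.exp (-2)) ^ L := by
            rw [hδ, ← Real.exp_add, ← Real.exp_nat_mul]; congr 1; ring
          rw [e1, pow_mul]
          have : (1 / 4 : ℝ) ^ 2 ≤ Real.exp (-2) := by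
            have h := Real.exp_one_lt_d9
            have h2 : Real.exp 2 = Real.exp 1 * Real.exp 1 := by
              rw [← Real.exp_add]; norm_num
            rw [Real.exp_neg, le_inv_comm₀ (by norm_num) (Real.exp_pos _), h2]
            norm_num
            nlinarith [Real.exp_pos 1]
          gcongr
        calc 8 * (1 / 4) ^ (2 * L) * ‖b‖ ^ 2 / (1 - ‖w (⟨j, hjJ⟩, s)‖)
            ≤ 8 * (1 / 4) ^ (2 * L) * ‖b‖ ^ 2 / (τ j / (64 * K * (L:ℝ) ^ p)) := by gcongr
          _ ≤ 8 * (δ * δ) * ‖b‖ ^ 2 / (2 * δ / (64 * K * (L:ℝ) ^ p)) := by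
              have := hτge j
              gcongr
          _ = ‖b‖ ^ 2 * (256 * K * (L:ℝ) ^ p * δ) := by
              field_simp; ring
          _ ≤ ‖b‖ ^ 2 * (1 / H) := by
              gcongr
              rw [le_div_iff₀ (by linarith)]
              rw [← hδ] at hE2
              calc 256 * K * (L:ℝ) ^ p * δ * H ≤ 256 * K * (L:ℝ) ^ p * δ * (K * L) := by gcongr
                _ = 256 * K ^ 2 * (L:ℝ) ^ (p + 1) * δ := by ring
                _ ≤ 1 := hE2
          _ = _ := by ring
      · have hfar := far_point hK hFre hφ r θ t₂ ht0 hr0 hr1 (by linarith) hcase.le hθpi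
        rw [ht₂, ← hρ] at hfar
        have hρ1 : ρ < 1 := by
          rw [hρ, Real.exp_lt_one_iff, neg_lt_zero]
          have := hK.2.2.2.2.2.1 (Real.exp (-L₁) / 2 / 2) (by positivity) (by
            rw [← ht₂]; linarith)
          positivity
        have hρ0 : 0 < ρ := by rw [hρ]; positivity
        have h1 := hy0 b hb0 _ ρ hfar hρ1
        have h1ρ : 0 < 1 - ρ := by linarith
        calc _ ≤ (‖b‖ * ρ ^ L / (1 - ρ)) ^ 2 := by gcongr
          _ = ‖b‖ ^ 2 * ((ρ ^ 2) ^ L / (1 - ρ) ^ 2) := by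
              rw [div_pow, mul_pow, ← pow_mul, ← pow_mul, mul_comm L 2]; ring
          _ ≤ ‖b‖ ^ 2 * (1 / H) := by
              gcongr ?_ * ?_
              rw [div_le_div_iff₀ (by positivity) (by positivity), one_mul]
              refine le_trans ?_ hE3
              rw [mul_comm]
              gcongr
          _ = _ := by ring
  rw [← hH]
  have hnn : 0 ≤ Real.sqrt (2305 / H) * ‖b‖ := by positivity
  refine abs_le_of_sq_le_sq' ?_ hnn |>.2
  rw [mul_pow, Real.sq_sqrt (by positivity)]
  exact hsq

lemma upper_core {U : ℝ → ℝ} (hK : ClassU U) {F φ : ℂ → ℂ} {L₁ K C : ℝ} {p : ℕ}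
    (hA : Analytic1 U L₁ K C p) (hF : DifferentiableOn ℂ F (Metric.ball 0 1))
    (hFre : ∀ r θ : ℝ, 0 ≤ r → r < 1 →
      (F ((r : ℂ) * Complex.exp (θ * Complex.I))).re = poisson U r θ)
    (hφ : ∀ z, φ z = Complex.exp (-F z)) (T : H2 →L[ℂ] H2)
    (hT : ∀ (a : H2) (z : ℂ), ‖z‖ < 1 → fa (T a) z = fa a (φ z)) :
    ∃ D q L₅ : ℕ, 1 ≤ D ∧ 1 ≤ q ∧ L₁ ≤ L₅ ∧ ∀ L : ℕ, L₅ ≤ L → ∀ n : ℕ, D * L ^ q ≤ n - 1 →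
      approxNum T n ≤ Real.sqrt (2305 / HL U L) := by
  have hpi := Real.pi_pos
  have hL3 := hA.hL
  obtain ⟨L₄, hL41, hrad⟩ := phi_radial hK hA hFre hφ
  obtain ⟨K₃, hK₃, hlip⟩ := lip_main hK hA
  obtain ⟨A, hAge⟩ := exists_nat_ge (max 2 (72 * 256 * K₃ * K))
  have hA2 : 2 ≤ A := by exact_mod_cast (le_max_left _ _).trans hAge
  have hAK : 72 * 256 * K₃ * K ≤ A := (le_max_right _ _).trans hAge
  obtain ⟨ρ, hρ⟩ : ∃ ρ, ρ = Real.exp (-(U (Real.exp (-L₁) / 2 / 2) / (4 * Real.pi))) := ⟨_, rfl⟩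
  have hρ1 : ρ < 1 := by
    rw [hρ, Real.exp_lt_one_iff, neg_lt_zero]
    have h1 : Real.exp (-L₁) < 1 := exp_neg_lt_one (by linarith)
    have := hK.2.2.2.2.2.1 (Real.exp (-L₁) / 2 / 2) (by positivity) (by
      linarith [Real.pi_gt_three])
    positivity
  have hρ0 : 0 < ρ := by rw [hρ]; positivity
  have hcast : Tendsto (fun L : ℕ => (L:ℝ)) atTop atTop := tendsto_natCast_atTop_atTop
  have e1 : ∀ (c : ℝ) (k : ℕ), ∀ᶠ L : ℕ in atTop, c * (L:ℝ) ^ k * Real.exp (-(L:ℝ)) ≤ 1 := by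
    intro c k
    have h := ((Real.tendsto_pow_mul_exp_neg_atTop_nhds_zero k).const_mul c).comp hcast
    rw [mul_zero] at h
    filter_upwards [h.eventually (ge_mem_nhds (show (0:ℝ) < 1 by norm_num))] with L hL
    simp only [Function.comp_apply] at hL
    rwa [mul_assoc]
  have e3 : ∀ᶠ L : ℕ in atTop, K * L * (ρ ^ 2) ^ L ≤ (1 - ρ) ^ 2 := by
    have h := (tendsto_self_mul_const_pow_of_lt_one (r := ρ ^ 2) (by positivity)
      (by nlinarith)).const_mul K
    rw [mul_zero] at h
    have hp : 0 < (1 - ρ) ^ 2 := by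
      have : 0 < 1 - ρ := by linarith
      positivity
    filter_upwards [h.eventually (ge_mem_nhds hp)] with L hL
    rwa [mul_assoc]
  have hev := (((e1 (5 * A) (p + 2)).and (e1 (256 * K ^ 2) (p + 1))).and
    (e3.and (hcast.eventually_ge_atTop L₄)))
  obtain ⟨L₅, hL₅⟩ := hev.exists_forall_of_atTop
  refine ⟨8 * A + 1, p + 4, L₅, by omega, by omega, hL41.trans (hL₅ L₅ le_rfl).2.2, fun L hL n hn => ?_⟩
  obtain ⟨⟨a1, a2⟩, a3, a4⟩ := hL₅ L hL
  exact upper_fixed hK hA hF hFre hφ T hT K₃ hK₃ hlip A L hA2 hAK (hL41.trans a4) (hrad L a4).1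
    a1 a2 ρ hρ a3 n hn

lemma upper_bound {U : ℝ → ℝ} (hK : ClassU U) {F φ : ℂ → ℂ} {L₁ K C : ℝ} {p : ℕ}
    (hA : Analytic1 U L₁ K C p) (hF : DifferentiableOn ℂ F (Metric.ball 0 1))
    (hFre : ∀ r θ : ℝ, 0 ≤ r → r < 1 →
      (F ((r : ℂ) * Complex.exp (θ * Complex.I))).re = poisson U r θ)
    (hφ : ∀ z, φ z = Complex.exp (-F z)) (T : H2 →L[ℂ] H2)
    (hT : ∀ (a : H2) (z : ℂ), ‖z‖ < 1 → fa (T a) z = fa a (φ z)) :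
    ∃ C₁ : ℝ, 0 < C₁ ∧ ∃ N : ℕ, ∀ n : ℕ, N ≤ n →
      1 ≤ HL U (Real.sqrt n) ∧
      approxNum T n ≤ C₁ * (HL U (Real.sqrt n)) ^ (-(1 : ℝ) / 2) := by
  obtain ⟨D, q, L₅, hD, hq, hL15, hcore⟩ := upper_core hK hA hF hFre hφ T hT
  have hL3 := hA.hL
  have hC := hA.hC
  obtain ⟨Q, hQ⟩ : ∃ Q : ℝ, Q = ((q + 1 : ℕ) : ℝ) := ⟨_, rfl⟩
  have hQ1 : 1 ≤ Q := by rw [hQ]; push_cast; linarith [(Nat.cast_nonneg q : (0:ℝ) ≤ q)]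
  have hQC : 1 ≤ Q ^ C := Real.one_le_rpow hQ1 hC.le
  obtain ⟨M, hM⟩ : ∃ M : ℕ, M = max L₅ (D * 2 ^ q) := ⟨_, rfl⟩
  obtain ⟨N₁, hN₁⟩ := exists_nat_ge (L₁ ^ 2)
  refine ⟨Real.sqrt (2305 * Q ^ C), by positivity, max (D * M ^ q + 1) N₁, fun n hn => ?_⟩
  have hn1 : D * M ^ q + 1 ≤ n := (le_max_left _ _).trans hn
  have hn2 : N₁ ≤ n := (le_max_right _ _).trans hn
  have hsq1 : L₁ ≤ Real.sqrt n := by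
    apply Real.le_sqrt_of_sq_le
    exact hN₁.trans (by exact_mod_cast hn2)
  have hone := hA.one_le _ hsq1
  refine ⟨hone, ?_⟩
  set L := Nat.findGreatest (fun k => D * k ^ q ≤ n - 1) n with hL
  have hMn : M ≤ n := by
    have : M ≤ M ^ q := Nat.le_self_pow (by omega) M
    nlinarith
  have hMP : D * M ^ q ≤ n - 1 := by omega
  have hML : M ≤ L := Nat.le_findGreatest hMn hMP
  have hLP : D * L ^ q ≤ n - 1 := Nat.findGreatest_spec (P := fun k => D * k ^ q ≤ n - 1) hMn hMP
  have hLn : L < n := by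
    have : L ≤ L ^ q := Nat.le_self_pow (by omega) L
    have : L ^ q ≤ D * L ^ q := Nat.le_mul_of_pos_left _ hD
    omega
  have hnot : ¬ (D * (L + 1) ^ q ≤ n - 1) :=
    Nat.findGreatest_is_greatest (P := fun k => D * k ^ q ≤ n - 1) (n := n) (Nat.lt_succ_self _) hLn
  have hM1 : L₅ ≤ M := by rw [hM]; exact le_max_left _ _
  have hM2 : D * 2 ^ q ≤ M := by rw [hM]; exact le_max_right _ _
  have hL1R : L₁ ≤ (L:ℝ) := hL15.trans (by exact_mod_cast hM1.trans hML)
  have hLone : 1 ≤ L := by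
    have : (1:ℝ) ≤ L := by linarith
    exact_mod_cast this
  have hnle : n ≤ L ^ (q + 1) := by
    have h1 : n ≤ D * (L + 1) ^ q := by omega
    have h2 : (L + 1) ^ q ≤ (2 * L) ^ q := Nat.pow_le_pow_left (by omega) q
    calc n ≤ D * (L + 1) ^ q := h1
      _ ≤ D * (2 * L) ^ q := Nat.mul_le_mul_left _ h2
      _ = (D * 2 ^ q) * L ^ q := by rw [mul_pow]; ring
      _ ≤ L * L ^ q := Nat.mul_le_mul_right _ (hM2.trans hML)
      _ = L ^ (q + 1) := by ring
  have happ := hcore L (hM1.trans hML) n hLP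
  have hHL : HL U (Real.sqrt n) ≤ Q ^ C * HL U L := by
    have hHLone := hA.one_le _ hL1R
    rcases le_total (Real.sqrt n) L with h | h
    · have := HL_mono hK _ _ (Real.sqrt_nonneg n) h
      nlinarith
    · apply hA.power Q L _ hQ1 hL1R h
      rw [hQ, Real.rpow_natCast, Real.sqrt_le_iff]
      refine ⟨by positivity, ?_⟩
      have h1 : (n:ℝ) ≤ (L:ℝ) ^ (q + 1) := by exact_mod_cast hnle
      have h2 : (1:ℝ) ≤ (L:ℝ) ^ (q + 1) := one_le_pow₀ (by linarith)
      nlinarith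
  refine happ.trans ?_
  have e : HL U (Real.sqrt n) ^ (-(1:ℝ) / 2) = Real.sqrt (1 / HL U (Real.sqrt n)) := by
    have hq : 0 ≤ HL U (Real.sqrt n) := by linarith
    generalize HL U (Real.sqrt n) = Q at hq
    rw [Real.sqrt_eq_rpow, one_div Q, ← Real.rpow_neg_one, ← Real.rpow_mul hq]
    norm_num
  rw [e, ← Real.sqrt_mul (by positivity)]
  apply Real.sqrt_le_sqrt
  have hHLone := hA.one_le _ hL1R
  rw [mul_one_div, div_le_div_iff₀ (by linarith) (by linarith)]
  nlinarith

theorem stmt0 (U U' : ℝ → ℝ) (hU_mem : ClassU U)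
    (hderiv : ∀ t ∈ Set.Ioc (0 : ℝ) Real.pi, HasDerivAt U (U' t) t)
    (c C t₀ : ℝ) (hc : 1 < c) (hC : 0 < C) (ht₀ : 0 < t₀ ∧ t₀ < 1)
    (hcond : ∀ t : ℝ, 0 < t → t < t₀ →
      t * U' t / U t ≤ 1 + c / |Real.log t| ∧
      U t / (t * hU U t) ≤ C / (|Real.log t| * Real.log |Real.log t|))
    (F : ℂ → ℂ) (hF : DifferentiableOn ℂ F (Metric.ball 0 1))
    (hFre : ∀ r θ : ℝ, 0 ≤ r → r < 1 →
      (F ((r : ℂ) * Complex.exp (θ * Complex.I))).re = poisson U r θ)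
    (hFim : (F 0).im = 0)
    (φ : ℂ → ℂ) (hφ : ∀ z, φ z = Complex.exp (-F z))
    (T : H2 →L[ℂ] H2)
    (hT : ∀ (a : H2) (z : ℂ), ‖z‖ < 1 → fa (T a) z = fa a (φ z)) :
    ∃ c₁ C₁ : ℝ, 0 < c₁ ∧ c₁ ≤ C₁ ∧ ∃ N : ℕ, ∀ n : ℕ, N ≤ n →
      c₁ * (hU U (Real.exp (-Real.sqrt n))) ^ (-(1 : ℝ) / 2) ≤ approxNum T n ∧
      approxNum T n ≤ C₁ * (hU U (Real.exp (-Real.sqrt n))) ^ (-(1 : ℝ) / 2) := by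
  obtain ⟨L₁, K, p, hA⟩ := analytic1 U U' hU_mem hderiv c C t₀ hc hC ht₀ hcond
  obtain ⟨c₁, hc₁, N₁, h₁⟩ := lower_bound hU_mem hA hFre hφ T hT
  obtain ⟨C₁, hC₁, N₂, h₂⟩ := upper_bound hU_mem hA hF hFre hφ T hT
  refine ⟨c₁, max c₁ C₁, hc₁, le_max_left _ _, max N₁ N₂, fun n hn => ?_⟩
  obtain ⟨h3, h4⟩ := h₂ n ((le_max_right _ _).trans hn)
  refine ⟨h₁ n ((le_max_left _ _).trans hn), h4.trans ?_⟩
  have : (0:ℝ) ≤ HL U (Real.sqrt n) ^ (-(1 : ℝ) / 2) := Real.rpow_nonneg (by linarith) _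
  exact mul_le_mul_of_nonneg_right (le_max_right _ _) this

end
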